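/- arXiv:1302.2009 — 6 statements merged into one kernel-verified Lean document; each statement's English description precedes it below -/
import Mathlib

section
/- For every t ≥ 0 and all x, y ∈ E, one has |Ψ₊(t,x) − Ψ₊(t,y)| ≤ K |x − y|, where K = 2 sup_{i∈ℒ_M, k∈ℕ} |μ^i_{kk}| + 2 λ̄ (1 + 2 f̄/f̲). In particular Ψ₊(t,·) is globally Lipschitz on E, uniformly in t. -/
open scoped BigOperators

/-- The drift `Ψ` of the Fokker–Planck equation of the discrete SLI model, defined
componentwise on families `x : ℒ_M × ℕ → ℝ`.  The component at `p = (i, j)` is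
`Σ_k μ^i_{kj} x^i_k + 1_{i ≥ 1} λ(t,i−1) f(j) x^{i−1}_j (Σ_l x^{i−1}_l)/(Σ_l f(l) x^{i−1}_l)
 − 1_{i ≤ M−1} λ(t,i) f(j) x^i_j (Σ_l x^i_l)/(Σ_l f(l) x^i_l)`;
the convention that a ratio vanishes when `Σ_l f(l) x_l` (equivalently, for nonnegative `x`,
`Σ_l x_l`) vanishes is automatic from the convention `a / 0 = 0`. -/
noncomputable def PsiFun (M : ℕ) (μ : Fin (M + 1) → ℕ → ℕ → ℝ)
    (lam : ℝ → Fin (M + 1) → ℝ) (f : ℕ → ℝ)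
    (t : ℝ) (x : Fin (M + 1) × ℕ → ℝ) (p : Fin (M + 1) × ℕ) : ℝ :=
  (∑' k : ℕ, μ p.1 k p.2 * x (p.1, k))
    + (if 1 ≤ (p.1 : ℕ) then
        lam t (p.1 - 1) * f p.2 * x (p.1 - 1, p.2) *
          (∑' l : ℕ, x (p.1 - 1, l)) / (∑' l : ℕ, f l * x (p.1 - 1, l))
      else 0)
    - (if (p.1 : ℕ) < M then
        lam t p.1 * f p.2 * x (p.1, p.2) *
          (∑' l : ℕ, x (p.1, l)) / (∑' l : ℕ, f l * x (p.1, l))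
      else 0)

/-- A kernel whose rows have `ℓ¹` norm at most `C` acts on `ℓ¹`. -/
theorem summable_kernel_mul {α β : Type*} {ν : α → β → ℝ} {C : ℝ} {d : α → ℝ}
    (hν : ∀ k, Summable fun j => |ν k j|) (hC : ∀ k, ∑' j, |ν k j| ≤ C)
    (hd : Summable fun k => |d k|) :
    Summable fun q : α × β => |ν q.1 q.2 * d q.1| := by
  rw [summable_prod_of_nonneg fun q => abs_nonneg _]
  refine ⟨fun k => by simpa only [abs_mul] using (hν k).mul_right _, ?_⟩
  refine Summable.of_nonneg_of_le (fun k => tsum_nonneg fun j => abs_nonneg _) (fun k => ?_)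
    (hd.mul_left C)
  simp only [abs_mul, tsum_mul_right]
  exact mul_le_mul_of_nonneg_right (hC k) (abs_nonneg _)

/-- The `ℓ¹` operator norm of a kernel is bounded by the largest `ℓ¹` norm of its rows. -/
theorem tsum_abs_kernel_mul_le {α β : Type*} {ν : α → β → ℝ} {C : ℝ} {d : α → ℝ}
    (hν : ∀ k, Summable fun j => |ν k j|) (hC : ∀ k, ∑' j, |ν k j| ≤ C)
    (hd : Summable fun k => |d k|) :
    (Summable fun j => |∑' k, ν k j * d k|) ∧
      ∑' j, |∑' k, ν k j * d k| ≤ C * ∑' k, |d k| := by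
  have hs := summable_kernel_mul hν hC hd
  have hs' : Summable fun q : β × α => |ν q.2 q.1 * d q.2| := hs.prod_symm
  have hle : ∀ j, |∑' k, ν k j * d k| ≤ ∑' k, |ν k j * d k| := fun j => by
    simpa only [Real.norm_eq_abs] using norm_tsum_le_tsum_norm (f := fun k => ν k j * d k)
      (by simpa only [Real.norm_eq_abs] using hs'.prod_factor j)
  have h1 : Summable fun j => |∑' k, ν k j * d k| :=
    Summable.of_nonneg_of_le (fun j => abs_nonneg _) hle hs'.prod
  refine ⟨h1, ?_⟩
  calc ∑' j, |∑' k, ν k j * d k| ≤ ∑' j, ∑' k, |ν k j * d k| := h1.tsum_le_tsum hle hs'.prod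
    _ = ∑' k, ∑' j, |ν k j * d k| := Summable.tsum_comm (f := fun k j => |ν k j * d k|) hs
    _ ≤ ∑' k, C * |d k| := by
      refine hs.prod.tsum_le_tsum (fun k => ?_) (hd.mul_left C)
      simp only [abs_mul, tsum_mul_right]
      exact mul_le_mul_of_nonneg_right (hC k) (abs_nonneg _)
    _ = C * ∑' k, |d k| := tsum_mul_left

/-- A summable row with zero sum, nonnegative off the entry `k`, has `ℓ¹` norm `2 |r k|`. -/
theorem hasSum_abs_intensity_row {r : ℕ → ℝ} {k : ℕ} (hoff : ∀ j, k ≠ j → 0 ≤ r j)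
    (hdiag : r k ≤ 0) (hr : Summable r) (hsum : ∑' j, r j = 0) :
    HasSum (fun j => |r j|) (2 * |r k|) := by
  have h := hr.hasSum.add (hasSum_ite_eq k (2 * |r k|))
  rw [hsum, zero_add] at h
  convert h using 2 with j
  by_cases hj : j = k
  · subst hj
    rw [if_pos rfl, abs_of_nonpos hdiag]
    ring
  · rw [if_neg hj, add_zero, abs_of_nonneg (hoff j (Ne.symm hj))]

/-- The positive part is a contraction of the real line. -/
theorem abs_max_zero_sub_max_zero_le (a b : ℝ) : |max a 0 - max b 0| ≤ |a - b| :=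
  abs_max_sub_max_le_abs a b 0

/-- If `f` is bounded between positive constants, the map `a ↦ f a (Σ a) / (Σ f a)` is Lipschitz
with constant `1 + 2 fu / fl` on the nonnegative cone of `ℓ¹`. -/
theorem tsum_abs_reweight_sub_le {f a b : ℕ → ℝ} {fl fu : ℝ} (hfl : 0 < fl)
    (hf : ∀ j, fl ≤ f j ∧ f j ≤ fu) (ha : ∀ j, 0 ≤ a j) (hb : ∀ j, 0 ≤ b j)
    (hsa : Summable a) (hsb : Summable b) :
    (Summable fun j => |f j * a j * (∑' l, a l) / (∑' l, f l * a l)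
        - f j * b j * (∑' l, b l) / (∑' l, f l * b l)|) ∧
      ∑' j, |f j * a j * (∑' l, a l) / (∑' l, f l * a l)
        - f j * b j * (∑' l, b l) / (∑' l, f l * b l)|
      ≤ (1 + 2 * fu / fl) * ∑' j, |a j - b j| := by
  have hf0 : ∀ j, 0 ≤ f j := fun j => hfl.le.trans (hf j).1
  have hfu : 0 < fu := hfl.trans_le ((hf 0).1.trans (hf 0).2)
  have hbd : ∀ {c : ℕ → ℝ}, (∀ j, 0 ≤ c j) → Summable c → Summable fun j => f j * c j :=
    fun {c} hc hs => Summable.of_nonneg_of_le (fun j => mul_nonneg (hf0 j) (hc j))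
      (fun j => mul_le_mul_of_nonneg_right (hf j).2 (hc j)) (hs.mul_left fu)
  have hFa := hbd ha hsa
  have hFb := hbd hb hsb
  have hd : Summable fun j => |a j - b j| := (hsa.sub hsb).abs
  have hFd : Summable fun j => f j * |a j - b j| := hbd (fun j => abs_nonneg _) hd
  have hlow : ∀ {c : ℕ → ℝ}, (∀ j, 0 ≤ c j) → Summable c →
      fl * (∑' l, c l) ≤ ∑' l, f l * c l := fun {c} hc hs => by
    rw [← tsum_mul_left]
    exact (hs.mul_left fl).tsum_le_tsum
      (fun j => mul_le_mul_of_nonneg_right (hf j).1 (hc j)) (hbd hc hs)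
  have hla := hlow ha hsa
  have hlb := hlow hb hsb
  have hSd : |(∑' l, a l) - ∑' l, b l| ≤ ∑' j, |a j - b j| := by
    rw [← hsa.tsum_sub hsb]
    simpa only [Real.norm_eq_abs] using norm_tsum_le_tsum_norm (f := fun j => a j - b j)
      (by simpa only [Real.norm_eq_abs] using hd)
  have hFFd : |(∑' l, f l * a l) - ∑' l, f l * b l| ≤ ∑' j, f j * |a j - b j| := by
    rw [← hFa.tsum_sub hFb]
    have he : ∀ j, ‖f j * a j - f j * b j‖ = f j * |a j - b j| := fun j => by
      rw [← mul_sub, Real.norm_eq_abs, abs_mul, abs_of_nonneg (hf0 j)]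
    simpa only [he, Real.norm_eq_abs] using
      norm_tsum_le_tsum_norm (f := fun j => f j * a j - f j * b j)
        (by simpa only [he] using hFd)
  have hFdu : ∑' j, f j * |a j - b j| ≤ fu * ∑' j, |a j - b j| := by
    rw [← tsum_mul_left]
    exact hFd.tsum_le_tsum (fun j => mul_le_mul_of_nonneg_right (hf j).2 (abs_nonneg _))
      (hd.mul_left fu)
  have hSb0 : 0 ≤ ∑' l, b l := tsum_nonneg hb
  have hSa0 : 0 ≤ ∑' l, a l := tsum_nonneg ha
  have hD0 : 0 ≤ ∑' j, |a j - b j| := tsum_nonneg fun j => abs_nonneg _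
  have hK : 1 ≤ 1 + 2 * fu / fl := by
    have : 0 ≤ 2 * fu / fl := by positivity
    linarith
  have hvan : ∀ {c : ℕ → ℝ}, (∀ j, 0 ≤ c j) → Summable c → (∑' l, f l * c l) = 0 →
      ∀ j, c j = 0 := fun {c} hc hs h j => by
    have h1 := hlow hc hs
    rw [h] at h1
    have h2 : (∑' l, c l) ≤ 0 := by
      by_contra! h3
      exact absurd (mul_pos hfl h3) (not_lt.mpr h1)
    exact le_antisymm ((hs.le_tsum j fun i _ => hc i).trans h2) (hc j)
  have hone : ∀ {c : ℕ → ℝ}, (∀ j, 0 ≤ c j) → Summable c → (∑' l, f l * c l) ≠ 0 →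
      HasSum (fun j => |f j * c j * (∑' l, c l) / (∑' l, f l * c l)|) (∑' l, c l) :=
    fun {c} hc hs h => by
    have h1 := ((hbd hc hs).hasSum.mul_right (∑' l, c l)).div_const (∑' l, f l * c l)
    rw [mul_div_cancel_left₀ _ h] at h1
    have h2 : ∀ j, 0 ≤ f j * c j * (∑' l, c l) / (∑' l, f l * c l) := fun j =>
      div_nonneg (mul_nonneg (mul_nonneg (hf0 j) (hc j)) (tsum_nonneg hc))
        (tsum_nonneg fun l => mul_nonneg (hf0 l) (hc l))
    simpa only [abs_of_nonneg (h2 _)] using h1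
  by_cases hA : (∑' l, f l * a l) = 0
  · have ha' := hvan ha hsa hA
    by_cases hB : (∑' l, f l * b l) = 0
    · have hb' := hvan hb hsb hB
      simp [ha', hb', summable_zero]
    · have h := hone hb hsb hB
      simp only [ha', mul_zero, zero_mul, zero_div, zero_sub, abs_neg, abs_of_nonneg (hb _)]
      exact ⟨h.summable, h.tsum_eq.trans_le (le_mul_of_one_le_left hSb0 hK)⟩
  by_cases hB : (∑' l, f l * b l) = 0
  · have hb' := hvan hb hsb hB
    have h := hone ha hsa hA
    simp only [hb', mul_zero, zero_mul, zero_div, sub_zero, abs_of_nonneg (ha _)]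
    exact ⟨h.summable, h.tsum_eq.trans_le (le_mul_of_one_le_left hSa0 hK)⟩
  set Sa := ∑' l, a l
  set Sb := ∑' l, b l
  set A := ∑' l, f l * a l with hAdef
  set B := ∑' l, f l * b l
  set D := ∑' j, |a j - b j|
  set FD := ∑' j, f j * |a j - b j|
  have hApos : 0 < A := lt_of_le_of_ne (tsum_nonneg fun l => mul_nonneg (hf0 l) (ha l)) (Ne.symm hA)
  have hBpos : 0 < B := lt_of_le_of_ne (tsum_nonneg fun l => mul_nonneg (hf0 l) (hb l)) (Ne.symm hB)
  have hpt : ∀ j, |f j * a j * Sa / A - f j * b j * Sb / B|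
      ≤ f j * a j * ((|Sa - Sb| + Sb / B * |A - B|) / A) + f j * |a j - b j| * (Sb / B) := by
    intro j
    have e : f j * a j * Sa / A - f j * b j * Sb / B
        = f j * a j * ((Sa - Sb) / A) + f j * a j * (Sb / B * (B - A) / A)
          + f j * (a j - b j) * (Sb / B) := by
      field_simp
      ring
    rw [e]
    refine (abs_add_three _ _ _).trans (le_of_eq ?_)
    have hr : 0 ≤ Sb / B := div_nonneg hSb0 hBpos.le
    simp only [abs_mul, abs_div, abs_of_nonneg (hf0 j), abs_of_nonneg (ha j),
      abs_of_pos hApos, abs_of_pos hBpos, abs_of_nonneg hSb0, abs_sub_comm B A]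
    ring
  have hub := (hFa.hasSum.mul_right ((|Sa - Sb| + Sb / B * |A - B|) / A)).add
    (hFd.hasSum.mul_right (Sb / B))
  have hs := Summable.of_nonneg_of_le (fun j => abs_nonneg _) hpt hub.summable
  refine ⟨hs, (hs.tsum_le_tsum hpt hub.summable).trans ?_⟩
  rw [hub.tsum_eq, ← hAdef, mul_div_cancel₀ _ hA]
  have hr0 : 0 ≤ Sb / B := div_nonneg hSb0 hBpos.le
  have hr : Sb / B ≤ 1 / fl := by
    rw [div_le_div_iff₀ hBpos hfl]
    linarith
  have h1 : Sb / B * |A - B| ≤ 1 / fl * (fu * D) :=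
    mul_le_mul hr (hFFd.trans hFdu) (abs_nonneg _) (by positivity)
  have h2 : FD * (Sb / B) ≤ fu * D * (1 / fl) :=
    mul_le_mul hFdu hr hr0 (by positivity)
  calc |Sa - Sb| + Sb / B * |A - B| + FD * (Sb / B)
      ≤ D + 1 / fl * (fu * D) + fu * D * (1 / fl) := by gcongr
    _ = (1 + 2 * fu / fl) * D := by ring

/-- The Lipschitz estimate for one transition term of the drift, with a rate `c ∈ [0, C]`. -/
theorem tsum_abs_transition_sub_le {f a b : ℕ → ℝ} {fl fu c C : ℝ} (hfl : 0 < fl)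
    (hf : ∀ j, fl ≤ f j ∧ f j ≤ fu) (hc : 0 ≤ c) (hcC : c ≤ C)
    (ha : Summable fun j => |a j|) (hb : Summable fun j => |b j|) :
    (Summable fun j =>
        |c * f j * max (a j) 0 * (∑' l, max (a l) 0) / (∑' l, f l * max (a l) 0)
        - c * f j * max (b j) 0 * (∑' l, max (b l) 0) / (∑' l, f l * max (b l) 0)|) ∧
      ∑' j, |c * f j * max (a j) 0 * (∑' l, max (a l) 0) / (∑' l, f l * max (a l) 0)
        - c * f j * max (b j) 0 * (∑' l, max (b l) 0) / (∑' l, f l * max (b l) 0)|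
      ≤ C * (1 + 2 * fu / fl) * ∑' j, |a j - b j| := by
  have hpos : ∀ {u : ℕ → ℝ}, (Summable fun j => |u j|) → Summable fun j => max (u j) 0 :=
    fun {u} hu => Summable.of_nonneg_of_le (fun j => le_max_right _ _)
      (fun j => max_le (le_abs_self _) (abs_nonneg _)) hu
  have hd : Summable fun j => |a j - b j| := (ha.of_abs.sub hb.of_abs).abs
  have hd' : Summable fun j => |max (a j) 0 - max (b j) 0| := ((hpos ha).sub (hpos hb)).abs
  obtain ⟨h1, h2⟩ := tsum_abs_reweight_sub_le hfl hf (fun j => le_max_right (a j) 0)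
    (fun j => le_max_right (b j) 0) (hpos ha) (hpos hb)
  have hfu : 0 < fu := hfl.trans_le ((hf 0).1.trans (hf 0).2)
  have e : ∀ j u v A u' v' B : ℝ, |c * j * u * v / A - c * j * u' * v' / B|
      = c * |j * u * v / A - j * u' * v' / B| := fun j u v A u' v' B => by
    rw [← abs_of_nonneg hc, ← abs_mul, abs_of_nonneg hc]
    congr 1
    ring
  simp only [e, tsum_mul_left]
  refine ⟨h1.mul_left c, ?_⟩
  rw [mul_assoc]
  refine mul_le_mul hcC (h2.trans ?_) (tsum_nonneg fun j => abs_nonneg _) (hc.trans hcC)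
  exact mul_le_mul_of_nonneg_left
    (hd'.tsum_le_tsum (fun j => abs_max_zero_sub_max_zero_le _ _) hd) (by positivity)

/-- `Ψ₊(t, ·) : x ↦ Ψ(t, x₊)` is globally Lipschitz on `ℓ¹(ℒ_M × ℕ)`,
uniformly in `t ≥ 0`, with Lipschitz constant
`K = 2 sup_{i,k} |μ^i_{kk}| + 2 λ̄ (1 + 2 f̄ / f̲)`. -/
theorem psiPlus_lipschitz (M : ℕ) (μ : Fin (M + 1) → ℕ → ℕ → ℝ)
    (lam : ℝ → Fin (M + 1) → ℝ) (f : ℕ → ℝ) (fl fu lamBar : ℝ)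
    -- bounds on `f`
    (hfl : 0 < fl) (hf : ∀ j : ℕ, fl ≤ f j ∧ f j ≤ fu)
    -- assumptions on the local intensity `λ`
    (hlamBar : 0 ≤ lamBar) (hlam : ∀ (t : ℝ) (i : Fin (M + 1)), 0 ≤ lam t i ∧ lam t i ≤ lamBar)
    (hlam_meas : ∀ i : Fin (M + 1), Measurable fun t => lam t i)
    (hlam_last : ∀ t : ℝ, lam t (Fin.last M) = 0)
    -- `μ^i` is an intensity matrix for every `i`
    (hμ_off : ∀ (i : Fin (M + 1)) (k j : ℕ), k ≠ j → 0 ≤ μ i k j)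
    (hμ_diag : ∀ (i : Fin (M + 1)) (k : ℕ), μ i k k ≤ 0)
    (hμ_row_summable : ∀ (i : Fin (M + 1)) (k : ℕ), Summable (μ i k))
    (hμ_row : ∀ (i : Fin (M + 1)) (k : ℕ), ∑' j : ℕ, μ i k j = 0)
    (hμ_bdd : ∀ i : Fin (M + 1), BddAbove (Set.range fun k : ℕ => |μ i k k|)) :
    ∀ t : ℝ, 0 ≤ t → ∀ x y : Fin (M + 1) × ℕ → ℝ,
      Summable (fun p => |x p|) → Summable (fun p => |y p|) →
      Summable (fun p =>
          |PsiFun M μ lam f t (fun q => max (x q) 0) p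
            - PsiFun M μ lam f t (fun q => max (y q) 0) p|) ∧
      (∑' p : Fin (M + 1) × ℕ,
          |PsiFun M μ lam f t (fun q => max (x q) 0) p
            - PsiFun M μ lam f t (fun q => max (y q) 0) p|)
        ≤ (2 * (⨆ i : Fin (M + 1), ⨆ k : ℕ, |μ i k k|)
              + 2 * lamBar * (1 + 2 * fu / fl)) * ∑' p : Fin (M + 1) × ℕ, |x p - y p| := by
  intro t _ x y hx hy
  set s := ⨆ i : Fin (M + 1), ⨆ k : ℕ, |μ i k k|
  have hs : ∀ i k, |μ i k k| ≤ s := fun i k => (le_ciSup (hμ_bdd i) k).trans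
    (le_ciSup (f := fun i => ⨆ k : ℕ, |μ i k k|) (Set.finite_range _).bddAbove i)
  have hs0 : 0 ≤ s := (abs_nonneg _).trans (hs 0 0)
  have hxi : ∀ i, Summable fun j => |x (i, j)| := hx.prod_factor
  have hyi : ∀ i, Summable fun j => |y (i, j)| := hy.prod_factor
  have hd : Summable fun p => |x p - y p| := (hx.of_abs.sub hy.of_abs).abs
  have hdi : ∀ i, Summable fun j => |x (i, j) - y (i, j)| := hd.prod_factor
  set D : Fin (M + 1) → ℝ := fun i => ∑' j, |x (i, j) - y (i, j)|
  set L := lamBar * (1 + 2 * fu / fl)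
  have hrow := fun i k => hasSum_abs_intensity_row (hμ_off i k) (hμ_diag i k)
    (hμ_row_summable i k) (hμ_row i k)
  have hrow_le : ∀ i k, ∑' j, |μ i k j| ≤ 2 * s := fun i k => by
    rw [(hrow i k).tsum_eq]
    linarith [hs i k]
  have hT := fun i => tsum_abs_transition_sub_le hfl hf (hlam t i).1 (hlam t i).2 (hxi i) (hyi i)
  have hpos : ∀ {u : Fin (M + 1) × ℕ → ℝ}, (∀ i, Summable fun j => |u (i, j)|) →
      ∀ i, Summable fun j => |max (u (i, j)) 0| := fun {u} hu i =>
    Summable.of_nonneg_of_le (fun j => abs_nonneg _)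
      (fun j => by simpa using abs_max_zero_sub_max_zero_le (u (i, j)) 0) (hu i)
  have hker : ∀ {u : Fin (M + 1) × ℕ → ℝ}, (∀ i, Summable fun j => |u (i, j)|) →
      ∀ i j, Summable fun k => μ i k j * max (u (i, k)) 0 := fun {u} hu i j =>
    ((summable_kernel_mul (fun k => (hrow i k).summable) (hrow_le i) (hpos hu i)).prod_symm
      |>.prod_factor j).of_abs
  have hμd := fun i => tsum_abs_kernel_mul_le (fun k => (hrow i k).summable) (hrow_le i)
    (((hpos hxi i).of_abs.sub (hpos hyi i).of_abs).abs)
  have hpt : ∀ i j,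
      |PsiFun M μ lam f t (fun q => max (x q) 0) (i, j)
        - PsiFun M μ lam f t (fun q => max (y q) 0) (i, j)|
      ≤ |∑' k, μ i k j * (max (x (i, k)) 0 - max (y (i, k)) 0)|
        + |lam t (i - 1) * f j * max (x (i - 1, j)) 0 * (∑' l, max (x (i - 1, l)) 0)
              / (∑' l, f l * max (x (i - 1, l)) 0)
            - lam t (i - 1) * f j * max (y (i - 1, j)) 0 * (∑' l, max (y (i - 1, l)) 0)
              / (∑' l, f l * max (y (i - 1, l)) 0)|
        + |lam t i * f j * max (x (i, j)) 0 * (∑' l, max (x (i, l)) 0)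
              / (∑' l, f l * max (x (i, l)) 0)
            - lam t i * f j * max (y (i, j)) 0 * (∑' l, max (y (i, l)) 0)
              / (∑' l, f l * max (y (i, l)) 0)| := by
    intro i j
    have e : ∑' k, μ i k j * (max (x (i, k)) 0 - max (y (i, k)) 0)
        = ∑' k, μ i k j * max (x (i, k)) 0 - ∑' k, μ i k j * max (y (i, k)) 0 := by
      rw [← (hker hxi i j).tsum_sub (hker hyi i j)]
      simp only [mul_sub]
    have tri : ∀ (P Q : Prop) [Decidable P] [Decidable Q] (a a' b b' c c' : ℝ),
        |(a + (if P then b else 0) - (if Q then c else 0))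
          - (a' + (if P then b' else 0) - (if Q then c' else 0))|
        ≤ |a - a'| + |b - b'| + |c - c'| := by
      intro P Q _ _ a a' b b' c c'
      have ha := abs_le.1 (le_refl |a - a'|)
      have hb := abs_le.1 (le_refl |b - b'|)
      have hc := abs_le.1 (le_refl |c - c'|)
      have hb0 := abs_nonneg (b - b')
      have hc0 := abs_nonneg (c - c')
      split_ifs <;> rw [abs_le] <;> constructor <;> linarith
    rw [e]
    exact tri _ _ _ _ _ _ _ _
  have hub := fun i => ((hμd i).1.add (hT (i - 1)).1).add (hT i).1
  have hrowS : ∀ i, Summable fun j =>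
      |PsiFun M μ lam f t (fun q => max (x q) 0) (i, j)
        - PsiFun M μ lam f t (fun q => max (y q) 0) (i, j)| := fun i =>
    Summable.of_nonneg_of_le (fun j => abs_nonneg _) (hpt i) (hub i)
  have hrowB : ∀ i, ∑' j,
      |PsiFun M μ lam f t (fun q => max (x q) 0) (i, j)
        - PsiFun M μ lam f t (fun q => max (y q) 0) (i, j)|
      ≤ 2 * s * D i + L * D (i - 1) + L * D i := fun i => by
    refine ((hrowS i).tsum_le_tsum (hpt i) (hub i)).trans ?_
    rw [((hμd i).1.add (hT (i - 1)).1).tsum_add (hT i).1, (hμd i).1.tsum_add (hT (i - 1)).1]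
    refine add_le_add (add_le_add ((hμd i).2.trans ?_) (hT (i - 1)).2) (hT i).2
    exact mul_le_mul_of_nonneg_left (((hpos hxi i).of_abs.sub (hpos hyi i).of_abs).abs.tsum_le_tsum
      (fun j => abs_max_zero_sub_max_zero_le _ _) (hdi i)) (by positivity)
  have hS := (summable_prod_of_nonneg fun p => abs_nonneg
    (PsiFun M μ lam f t (fun q => max (x q) 0) p
      - PsiFun M μ lam f t (fun q => max (y q) 0) p)).2 ⟨hrowS, (hasSum_fintype _).summable⟩
  refine ⟨hS, ?_⟩
  have hshift : ∑ i, D (i - 1) = ∑ i, D i := Equiv.sum_comp (Equiv.subRight 1) D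
  rw [hS.tsum_prod, hd.tsum_prod, tsum_fintype, tsum_fintype]
  refine (Finset.sum_le_sum fun i _ => hrowB i).trans (le_of_eq ?_)
  rw [Finset.sum_add_distrib, Finset.sum_add_distrib, ← Finset.mul_sum, ← Finset.mul_sum,
    ← Finset.mul_sum, hshift]
  ring
end

section
/- For every absolutely summable real sequence z = (z_k)_{k∈ℕ}, the series Σ_k μ_{kj} z_k converges absolutely for each j, and Σ_{j∈ℕ} |Σ_{k∈ℕ} μ_{kj} z_k| ≤ 2 (sup_{k∈ℕ} |μ_{kk}|) Σ_{k∈ℕ} |z_k|. In other words, the transpose action z ↦ (Σ_k μ_{kj} z_k)_j of an intensity matrix is a bounded operator on ℓ¹(ℕ) with norm at most 2 sup_k |μ_{kk}|. -/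
open scoped BigOperators

/-- Each row of an intensity matrix has `ℓ¹`-norm equal to twice the modulus of its diagonal
entry. -/
theorem hasSum_abs_intensity_row_s1 {ι : Type*} {a : ι → ℝ} {k : ι}
    (h_off : ∀ j, k ≠ j → 0 ≤ a j) (h_diag : a k ≤ 0)
    (h_summable : Summable a) (h_sum : ∑' j, a j = 0) :
    HasSum (fun j => |a j|) (2 * |a k|) := by
  classical
  have h := (h_sum ▸ h_summable.hasSum).add (hasSum_ite_eq k (2 * |a k|))
  rw [zero_add] at h
  refine h.congr_fun fun j => ?_
  by_cases hj : j = k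
  · subst hj
    rw [if_pos rfl, abs_of_nonpos h_diag]
    ring
  · rw [if_neg hj, abs_of_nonneg (h_off j (Ne.symm hj)), add_zero]

/-- A matrix whose rows are uniformly bounded in `ℓ¹` gives an absolutely summable double family
when its rows are weighted by an absolutely summable sequence. -/
theorem summable_abs_mul_of_rows_le {ι κ : Type*} {a : ι → κ → ℝ} {C : ℝ}
    (h_rows : ∀ k, Summable fun j => |a k j|) (h_le : ∀ k, ∑' j, |a k j| ≤ C)
    {z : ι → ℝ} (hz : Summable fun k => |z k|) :
    Summable fun p : ι × κ => |a p.1 p.2 * z p.1| := by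
  refine (summable_prod_of_nonneg fun p => abs_nonneg _).2 ⟨fun k => ?_, ?_⟩
  · simpa only [abs_mul] using (h_rows k).mul_right |z k|
  · refine (hz.mul_left C).of_nonneg_of_le (fun k => tsum_nonneg fun j => abs_nonneg _)
      fun k => ?_
    simp only [abs_mul, tsum_mul_right]
    exact mul_le_mul_of_nonneg_right (h_le k) (abs_nonneg _)

/-- The transpose of a matrix whose rows are bounded by `C` in `ℓ¹` acts on `ℓ¹` with norm at
most `C`. -/
theorem transpose_bounded_l1_of_rows_le {ι κ : Type*} {a : ι → κ → ℝ} {C : ℝ}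
    (h_rows : ∀ k, Summable fun j => |a k j|) (h_le : ∀ k, ∑' j, |a k j| ≤ C)
    {z : ι → ℝ} (hz : Summable fun k => |z k|) :
    (∀ j, Summable fun k => |a k j * z k|) ∧
      Summable (fun j => |∑' k, a k j * z k|) ∧
      ∑' j, |∑' k, a k j * z k| ≤ C * ∑' k, |z k| := by
  have h := summable_abs_mul_of_rows_le h_rows h_le hz
  have h_swap : Summable fun p : κ × ι => |a p.2 p.1 * z p.2| := h.prod_symm
  have h_cols : ∀ j, Summable fun k => |a k j * z k| := fun j => h_swap.prod_factor j
  have h_abs_le : ∀ j, |∑' k, a k j * z k| ≤ ∑' k, |a k j * z k| := fun j =>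
    norm_tsum_le_tsum_norm (f := fun k => a k j * z k) (h_cols j)
  have h_outer : Summable fun j => ∑' k, |a k j * z k| := h_swap.prod
  have h_left : Summable fun j => |∑' k, a k j * z k| :=
    h_outer.of_nonneg_of_le (fun _ => abs_nonneg _) h_abs_le
  refine ⟨h_cols, h_left, ?_⟩
  calc ∑' j, |∑' k, a k j * z k|
      ≤ ∑' j, ∑' k, |a k j * z k| := h_left.tsum_le_tsum h_abs_le h_outer
    _ = ∑' k, ∑' j, |a k j * z k| :=
      Summable.tsum_comm (f := fun k j => |a k j * z k|) h
    _ ≤ ∑' k, C * |z k| := by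
      refine Summable.tsum_le_tsum (fun k => ?_) h.prod (hz.mul_left C)
      simp only [abs_mul, tsum_mul_right]
      exact mul_le_mul_of_nonneg_right (h_le k) (abs_nonneg _)
    _ = C * ∑' k, |z k| := tsum_mul_left

/-- The transpose action `z ↦ (Σ_k μ_{kj} z_k)_j` of an intensity matrix
`μ` is a bounded operator on `ℓ¹(ℕ)` with norm at most `2 sup_k |μ_{kk}|`: for every
absolutely summable `z`, the series `Σ_k μ_{kj} z_k` converges absolutely for each `j`,
the resulting family is absolutely summable in `j`, and
`Σ_j |Σ_k μ_{kj} z_k| ≤ 2 (sup_k |μ_{kk}|) Σ_k |z_k|`. -/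
theorem intensity_transpose_bounded_l1 (μ : ℕ → ℕ → ℝ)
    -- `μ` is an intensity matrix
    (hμ_off : ∀ k j : ℕ, k ≠ j → 0 ≤ μ k j)
    (hμ_diag : ∀ k : ℕ, μ k k ≤ 0)
    (hμ_row_summable : ∀ k : ℕ, Summable (μ k))
    (hμ_row : ∀ k : ℕ, ∑' j : ℕ, μ k j = 0)
    (hμ_bdd : BddAbove (Set.range fun k : ℕ => |μ k k|)) :
    ∀ z : ℕ → ℝ, Summable (fun k => |z k|) →
      (∀ j : ℕ, Summable (fun k => |μ k j * z k|)) ∧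
      Summable (fun j => |∑' k : ℕ, μ k j * z k|) ∧
      ∑' j : ℕ, |∑' k : ℕ, μ k j * z k|
        ≤ 2 * (⨆ k : ℕ, |μ k k|) * ∑' k : ℕ, |z k| := by
  intro z hz
  have h_row := fun k =>
    hasSum_abs_intensity_row_s1 (hμ_off k) (hμ_diag k) (hμ_row_summable k) (hμ_row k)
  refine transpose_bounded_l1_of_rows_le (fun k => (h_row k).summable) (fun k => ?_) hz
  rw [(h_row k).tsum_eq]
  exact mul_le_mul_of_nonneg_left (le_ciSup hμ_bdd k) zero_le_two
end

section
/- For all nonnegative absolutely summable sequences x = (x_j)_{j∈ℕ} and y = (y_j)_{j∈ℕ} with Σ_l f(l) x_l > 0 and Σ_l f(l) y_l > 0, one has Σ_{j∈ℕ} f(j) | x_j (Σ_l x_l)/(Σ_l f(l) x_l) − y_j (Σ_l y_l)/(Σ_l f(l) y_l) | ≤ (1 + 2 f̄/f̲) Σ_{l∈ℕ} |x_l − y_l|. -/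
open scoped BigOperators

/-- A sequence with values in `[fl, fu]`, where `0 < fl`, preserves summability of nonnegative
sequences under multiplication. -/
lemma summable_mul_of_bounded {f : ℕ → ℝ} {fl fu : ℝ} (hfl : 0 < fl)
    (hf : ∀ j, fl ≤ f j ∧ f j ≤ fu) {z : ℕ → ℝ} (hz : ∀ j, 0 ≤ z j) (hs : Summable z) :
    Summable fun j => f j * z j :=
  (hs.mul_left fu).of_nonneg_of_le (fun j => mul_nonneg (hfl.le.trans (hf j).1) (hz j))
    fun j => mul_le_mul_of_nonneg_right (hf j).2 (hz j)

/-- The absolute difference of two sums is at most the sum of the absolute differences. -/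
lemma abs_tsum_sub_tsum_le {x y : ℕ → ℝ} (hx : Summable x) (hy : Summable y) :
    |∑' l, x l - ∑' l, y l| ≤ ∑' l, |x l - y l| := by
  rw [← hx.tsum_sub hy]
  simpa only [Real.norm_eq_abs] using norm_tsum_le_tsum_norm (hx.sub hy).norm

/-- For `f : ℕ → ℝ` with `0 < f̲ ≤ f ≤ f̄` and nonnegative absolutely
summable sequences `x, y` with `Σ_l f(l) x_l > 0` and `Σ_l f(l) y_l > 0`, one has
`Σ_j f(j) |x_j (Σ_l x_l)/(Σ_l f(l) x_l) − y_j (Σ_l y_l)/(Σ_l f(l) y_l)|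
  ≤ (1 + 2 f̄/f̲) Σ_l |x_l − y_l|`. -/
theorem weighted_ratio_lipschitz (f : ℕ → ℝ) (fl fu : ℝ)
    (hfl : 0 < fl) (hf : ∀ j : ℕ, fl ≤ f j ∧ f j ≤ fu) :
    ∀ x y : ℕ → ℝ,
      (∀ j, 0 ≤ x j) → (∀ j, 0 ≤ y j) → Summable x → Summable y →
      0 < (∑' l : ℕ, f l * x l) → 0 < (∑' l : ℕ, f l * y l) →
      Summable (fun j : ℕ =>
          f j * |x j * (∑' l : ℕ, x l) / (∑' l : ℕ, f l * x l)
                  - y j * (∑' l : ℕ, y l) / (∑' l : ℕ, f l * y l)|) ∧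
      ∑' j : ℕ, f j * |x j * (∑' l : ℕ, x l) / (∑' l : ℕ, f l * x l)
                  - y j * (∑' l : ℕ, y l) / (∑' l : ℕ, f l * y l)|
        ≤ (1 + 2 * fu / fl) * ∑' l : ℕ, |x l - y l| := by
  intro x y hx hy sx sy hF hG
  have f_nonneg (j : ℕ) : 0 ≤ f j := hfl.le.trans (hf j).1
  have sfx := summable_mul_of_bounded hfl hf hx sx
  have sfy := summable_mul_of_bounded hfl hf hy sy
  have sd : Summable fun j => |x j - y j| := (sx.sub sy).abs
  have sfd := summable_mul_of_bounded hfl hf (fun j => abs_nonneg (x j - y j)) sd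
  have hXY := abs_tsum_sub_tsum_le sx sy
  have hFG : |∑' l, f l * x l - ∑' l, f l * y l| ≤ ∑' l, f l * |x l - y l| := by
    refine (abs_tsum_sub_tsum_le sfx sfy).trans_eq (tsum_congr fun l => ?_)
    rw [← mul_sub, abs_mul, abs_of_nonneg (f_nonneg l)]
  have hE : ∑' l, f l * |x l - y l| ≤ fu * ∑' l, |x l - y l| := by
    rw [← tsum_mul_left]
    exact sfd.tsum_le_tsum (fun l => mul_le_mul_of_nonneg_right (hf l).2 (abs_nonneg _))
      (sd.mul_left fu)
  have hXF : fl * ∑' l, x l ≤ ∑' l, f l * x l := by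
    rw [← tsum_mul_left]
    exact (sx.mul_left fl).tsum_le_tsum (fun l => mul_le_mul_of_nonneg_right (hf l).1 (hx l)) sfx
  have hX : 0 ≤ ∑' l, x l := tsum_nonneg hx
  have hE0 : 0 ≤ ∑' l, f l * |x l - y l| :=
    tsum_nonneg fun l => mul_nonneg (f_nonneg l) (abs_nonneg _)
  set X := ∑' l, x l
  set Y := ∑' l, y l
  set F := ∑' l, f l * x l
  set G := ∑' l, f l * y l with hGdef
  set D := ∑' l, |x l - y l|
  set E := ∑' l, f l * |x l - y l| with hEdef
  have ha : 0 ≤ X / F := by positivity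
  have ha' : X / F ≤ 1 / fl := by
    rw [div_le_div_iff₀ hF hfl]
    linarith
  have hterm (j : ℕ) : f j * |x j * X / F - y j * Y / G| ≤
      X / F * (f j * |x j - y j|) + |X / F - Y / G| * (f j * y j) := by
    have h : x j * X / F - y j * Y / G = X / F * (x j - y j) + (X / F - Y / G) * y j := by ring
    have h' := abs_add_le (X / F * (x j - y j)) ((X / F - Y / G) * y j)
    rw [← h, abs_mul, abs_mul, abs_of_nonneg ha, abs_of_nonneg (hy j)] at h'
    linarith [mul_le_mul_of_nonneg_left h' (f_nonneg j)]
  have sbound := (sfd.mul_left (X / F)).add (sfy.mul_left |X / F - Y / G|)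
  have sterm := sbound.of_nonneg_of_le (fun j => mul_nonneg (f_nonneg j) (abs_nonneg _)) hterm
  refine ⟨sterm, ?_⟩
  have hsum := sterm.tsum_le_tsum hterm sbound
  rw [(sfd.mul_left _).tsum_add (sfy.mul_left _), tsum_mul_left, tsum_mul_left, ← hGdef,
    ← hEdef] at hsum
  have hratio : |X / F - Y / G| * G ≤ D + X / F * E := by
    have h : (X / F - Y / G) * G = (X - Y) - X / F * (F - G) := by
      field_simp
      ring
    rw [← abs_of_pos hG, ← abs_mul, abs_of_pos hG, h]
    refine (abs_sub _ _).trans ?_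
    rw [abs_mul, abs_of_nonneg ha]
    gcongr
  have hEa : X / F * E ≤ fu / fl * D :=
    calc X / F * E ≤ 1 / fl * (fu * D) := by gcongr
      _ = fu / fl * D := by ring
  calc _ ≤ D + 2 * (fu / fl * D) := by linarith
    _ = (1 + 2 * fu / fl) * D := by ring
end

section
/- For every t ≥ 0 and every x ∈ E with all components nonnegative, the double series Σ_{i∈ℒ_M} Σ_{j∈ℕ} (Ψ(t,x))_j^i converges absolutely and its sum equals 0. (Consequently the evolution generated by Ψ conserves the total mass Σ_{i,j} x_j^i.) -/
open scoped BigOperators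

/-- The absolute row sums of an intensity matrix are twice the absolute diagonal entries. -/
theorem tsum_abs_intensity_row {a : ℕ → ℝ} {k : ℕ} (h_off : ∀ j, k ≠ j → 0 ≤ a j)
    (h_diag : a k ≤ 0) (h_sum : Summable a) (h_zero : ∑' j, a j = 0) :
    ∑' j, |a j| = 2 * |a k| := by
  have h_abs : ∀ j, |a j| = a j + if j = k then 2 * |a k| else 0 := by
    intro j
    split_ifs with h
    · subst h
      rw [abs_of_nonpos h_diag]
      ring
    · rw [abs_of_nonneg (h_off j (Ne.symm h)), add_zero]
  rw [tsum_congr h_abs, h_sum.tsum_add (hasSum_ite_eq k _).summable, h_zero, tsum_ite_eq, zero_add]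

/-- A bounded intensity matrix maps summable sequences to summable sequences of total mass zero. -/
theorem hasSum_intensity_action {q : ℕ → ℕ → ℝ} {y : ℕ → ℝ}
    (h_off : ∀ k j, k ≠ j → 0 ≤ q k j) (h_diag : ∀ k, q k k ≤ 0)
    (h_sum : ∀ k, Summable (q k)) (h_zero : ∀ k, ∑' j, q k j = 0)
    (h_bdd : BddAbove (Set.range fun k => |q k k|)) (hy : Summable y) :
    HasSum (fun j => ∑' k, q k j * y k) 0 := by
  obtain ⟨C, hC⟩ := h_bdd
  have h_double : Summable (fun p : ℕ × ℕ => q p.1 p.2 * y p.1) := by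
    rw [← summable_abs_iff, summable_prod_of_nonneg fun _ => abs_nonneg _]
    refine ⟨fun k => ((h_sum k).mul_right (y k)).abs, ?_⟩
    refine Summable.of_nonneg_of_le (fun k => tsum_nonneg fun _ => abs_nonneg _) (fun k => ?_)
      (hy.abs.mul_left (2 * C))
    simp only [abs_mul]
    rw [tsum_mul_right, tsum_abs_intensity_row (h_off k) (h_diag k) (h_sum k) (h_zero k)]
    have : |q k k| ≤ C := hC ⟨k, rfl⟩
    gcongr
  have h_swap : Summable (fun p : ℕ × ℕ => q p.2 p.1 * y p.2) := h_double.prod_symm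
  have h_total : ∑' j, ∑' k, q k j * y k = 0 := by
    have h_comm : ∑' j, ∑' k, q k j * y k = ∑' k, ∑' j, q k j * y k :=
      Summable.tsum_comm (f := fun k j => q k j * y k) h_double
    rw [h_comm]
    simp only [tsum_mul_right, h_zero, zero_mul, tsum_zero]
  rw [← h_total]
  exact h_swap.prod.hasSum

/-- Redistributing the mass of a nonnegative summable sequence proportionally to positive bounded
weights preserves the total mass, up to the factor `c`. -/
theorem hasSum_weighted_redistribution {f y : ℕ → ℝ} {fl fu : ℝ} (c : ℝ) (hfl : 0 < fl)
    (hf : ∀ j, fl ≤ f j ∧ f j ≤ fu) (hy0 : ∀ j, 0 ≤ y j) (hy : Summable y) :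
    HasSum (fun j => c * f j * y j * (∑' l, y l) / (∑' l, f l * y l)) (c * ∑' l, y l) := by
  have hfy0 : ∀ j, 0 ≤ f j * y j := fun j => mul_nonneg (hfl.le.trans (hf j).1) (hy0 j)
  have hfy : Summable (fun j => f j * y j) :=
    Summable.of_nonneg_of_le hfy0 (fun j => mul_le_mul_of_nonneg_right (hf j).2 (hy0 j))
      (hy.mul_left fu)
  by_cases hF : ∑' l, f l * y l = 0
  · have hy_zero : ∀ j, y j = 0 := fun j => by
      have h : f j * y j ≤ 0 := hF ▸ hfy.le_tsum j fun i _ => hfy0 i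
      exact (mul_eq_zero.1 (h.antisymm (hfy0 j))).resolve_left (hfl.trans_le (hf j).1).ne'
    simp [hy_zero, hasSum_zero]
  · have h := hfy.hasSum.mul_left (c * (∑' l, y l) / ∑' l, f l * y l)
    rw [div_mul_cancel₀ _ hF] at h
    have h_terms : (fun j => c * f j * y j * (∑' l, y l) / ∑' l, f l * y l) =
        fun j => c * (∑' l, y l) / (∑' l, f l * y l) * (f j * y j) := by
      funext j
      ring
    rwa [h_terms]

/-- The incoming and outgoing flows along a finite chain of levels cancel. -/
theorem sum_chain_flow_eq_zero (M : ℕ) (G : Fin (M + 1) → ℝ) :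
    ∑ i : Fin (M + 1), ((if 1 ≤ (i : ℕ) then G (i - 1) else 0)
      - (if (i : ℕ) < M then G i else 0)) = 0 := by
  rw [Finset.sum_sub_distrib, Fin.sum_univ_succ, Fin.sum_univ_castSucc (n := M), sub_eq_zero]
  have h_pred : ∀ i : Fin M, i.succ - 1 = i.castSucc := fun i => by
    rw [← Fin.coeSucc_eq_succ, add_sub_cancel_right]
  simp [h_pred]

/-- For every `t ≥ 0` and every nonnegative `x ∈ ℓ¹(ℒ_M × ℕ)`, the double
series `Σ_{i,j} (Ψ(t,x))_j^i` converges absolutely and its sum equals `0`: the evolution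
generated by `Ψ` conserves the total mass. -/
theorem psi_mass_conservation (M : ℕ) (μ : Fin (M + 1) → ℕ → ℕ → ℝ)
    (lam : ℝ → Fin (M + 1) → ℝ) (f : ℕ → ℝ) (fl fu lamBar : ℝ)
    -- bounds on `f`
    (hfl : 0 < fl) (hf : ∀ j : ℕ, fl ≤ f j ∧ f j ≤ fu)
    -- assumptions on the local intensity `λ`
    (hlamBar : 0 ≤ lamBar) (hlam : ∀ (t : ℝ) (i : Fin (M + 1)), 0 ≤ lam t i ∧ lam t i ≤ lamBar)
    (hlam_meas : ∀ i : Fin (M + 1), Measurable fun t => lam t i)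
    (hlam_last : ∀ t : ℝ, lam t (Fin.last M) = 0)
    -- `μ^i` is an intensity matrix for every `i`
    (hμ_off : ∀ (i : Fin (M + 1)) (k j : ℕ), k ≠ j → 0 ≤ μ i k j)
    (hμ_diag : ∀ (i : Fin (M + 1)) (k : ℕ), μ i k k ≤ 0)
    (hμ_row_summable : ∀ (i : Fin (M + 1)) (k : ℕ), Summable (μ i k))
    (hμ_row : ∀ (i : Fin (M + 1)) (k : ℕ), ∑' j : ℕ, μ i k j = 0)
    (hμ_bdd : ∀ i : Fin (M + 1), BddAbove (Set.range fun k : ℕ => |μ i k k|)) :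
    ∀ t : ℝ, 0 ≤ t → ∀ x : Fin (M + 1) × ℕ → ℝ,
      (∀ p, 0 ≤ x p) → Summable x →
      Summable (fun p => |PsiFun M μ lam f t x p|) ∧
      ∑' p : Fin (M + 1) × ℕ, PsiFun M μ lam f t x p = 0 := by
  intro t _ x hx0 hx
  have hx_row : ∀ i, Summable (fun j => x (i, j)) := fun i => hx.prod_factor i
  set G : Fin (M + 1) → ℝ := fun i => lam t i * ∑' l, x (i, l) with hG
  have h_flow : ∀ i, HasSum (fun j => lam t i * f j * x (i, j) * (∑' l, x (i, l)) /
      (∑' l, f l * x (i, l))) (G i) := fun i =>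
    hasSum_weighted_redistribution (lam t i) hfl hf (fun j => hx0 (i, j)) (hx_row i)
  have h_row : ∀ i : Fin (M + 1), HasSum (fun j => PsiFun M μ lam f t x (i, j))
      ((if 1 ≤ (i : ℕ) then G (i - 1) else 0) - (if (i : ℕ) < M then G i else 0)) := by
    intro i
    have h_local := hasSum_intensity_action (hμ_off i) (hμ_diag i) (hμ_row_summable i)
      (hμ_row i) (hμ_bdd i) (hx_row i)
    rw [← zero_add (if 1 ≤ (i : ℕ) then G (i - 1) else 0)]
    unfold PsiFun
    refine (h_local.add ?_).sub ?_
    · split_ifs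
      · exact h_flow (i - 1)
      · exact hasSum_zero
    · split_ifs
      · exact h_flow i
      · exact hasSum_zero
  have h_abs : Summable (fun p => |PsiFun M μ lam f t x p|) := by
    rw [summable_prod_of_nonneg fun _ => abs_nonneg _]
    exact ⟨fun i => (h_row i).summable.abs, Summable.of_finite⟩
  refine ⟨h_abs, ?_⟩
  rw [h_abs.of_abs.tsum_prod, tsum_fintype, Finset.sum_congr rfl fun i _ => (h_row i).tsum_eq]
  exact sum_chain_flow_eq_zero M G
end

section
/- Fix (x₀, y₀) ∈ ℒ_M × ℕ and let P₀ ∈ E be the family with (P₀)_{y₀}^{x₀} = 1 and all other entries 0. Then there exists a unique continuous function P : [0,∞) → E satisfying simultaneously: (i) P(t) = P₀ + ∫₀ᵗ Ψ(s, P(s)) ds (Bochner integral in E) for all t ≥ 0; (ii) P_j^i(t) ≥ 0 for all i ∈ ℒ_M, j ∈ ℕ, t ≥ 0; and (iii) |P(t)| = Σ_{i,j} P_j^i(t) = 1 for all t ≥ 0. (This is the unique solution of the Fokker–Planck equation of the discrete stochastic local intensity model.) -/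
open scoped BigOperators
open MeasureTheory Set

/-- The Banach space `E = ℓ¹(ℒ_M × ℕ)`. -/
noncomputable abbrev SLIl1 (M : ℕ) := lp (fun _ : Fin (M + 1) × ℕ => ℝ) 1

/-- A continuous `P : [0,∞) → ℓ¹(ℒ_M × ℕ)` solves the Fokker–Planck equation of the
discrete SLI model with initial condition `δ_{(x₀,y₀)}`, is componentwise nonnegative,
and has total mass one at every time. -/
noncomputable def SolvesSLIFP (M : ℕ) (μ : Fin (M + 1) → ℕ → ℕ → ℝ)
    (lam : ℝ → Fin (M + 1) → ℝ) (f : ℕ → ℝ) (x₀ : Fin (M + 1)) (y₀ : ℕ)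
    (P : ℝ → SLIl1 M) : Prop :=
  ContinuousOn P (Ici 0) ∧
  (∃ G : ℝ → SLIl1 M,
      (∀ s ∈ Ici (0 : ℝ), ∀ q, G s q = PsiFun M μ lam f s (fun r => P s r) q) ∧
      ∀ t ∈ Ici (0 : ℝ),
        P t = lp.single 1 (x₀, y₀) (1 : ℝ) + ∫ s in Ioc (0 : ℝ) t, G s) ∧
  (∀ t ∈ Ici (0 : ℝ), ∀ q, 0 ≤ P t q) ∧
  (∀ t ∈ Ici (0 : ℝ), ‖P t‖ = 1)

section CaratheodoryODE

variable {E : Type*} [NormedAddCommGroup E]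

/-- A time-dependent vector field that vanishes at the origin, is Lipschitz on `C` uniformly in
time, and is measurable along continuous curves in `C`. -/
structure CaratheodoryOn (C : Set E) (L : ℝ) (Φ : ℝ → E → E) : Prop where
  map_zero : ∀ t, Φ t 0 = 0
  lipschitz : ∀ t, ∀ x ∈ C, ∀ y ∈ C, ‖Φ t x - Φ t y‖ ≤ L * ‖x - y‖
  aestronglyMeasurable : ∀ w : ℝ → E, Continuous w → (∀ t, w t ∈ C) →
    AEStronglyMeasurable (fun s => Φ s (w s)) volume

namespace CaratheodoryOn

variable {C : Set E} {L : ℝ} {Φ : ℝ → E → E}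

theorem norm_le (h : CaratheodoryOn C L Φ) (h0 : (0 : E) ∈ C) (t : ℝ) {x : E} (hx : x ∈ C) :
    ‖Φ t x‖ ≤ L * ‖x‖ := by
  simpa [h.map_zero t] using h.lipschitz t x hx 0 h0

theorem intervalIntegrable (h : CaratheodoryOn C L Φ) (h0 : (0 : E) ∈ C) {w : ℝ → E}
    (hw : Continuous w) (hwC : ∀ t, w t ∈ C) (a b : ℝ) :
    IntervalIntegrable (fun s => Φ s (w s)) volume a b := by
  have hb : IntervalIntegrable (fun s => L * ‖w s‖) volume a b :=
    (continuous_const.mul hw.norm).intervalIntegrable a b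
  exact hb.mono_fun' (h.aestronglyMeasurable w hw hwC).restrict
    (Filter.Eventually.of_forall fun s => h.norm_le h0 s (hwC s))

variable [NormedSpace ℝ E]

/-- Adding a multiple of the identity preserves the Carathéodory conditions. -/
theorem add_smul_id (h : CaratheodoryOn C L Φ) {K : ℝ} (hK : 0 ≤ K) :
    CaratheodoryOn C (L + K) (fun t x => Φ t x + K • x) where
  map_zero t := by simp [h.map_zero t]
  lipschitz t x hx y hy := by
    calc ‖Φ t x + K • x - (Φ t y + K • y)‖ = ‖(Φ t x - Φ t y) + K • (x - y)‖ := by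
          congr 1; rw [smul_sub]; abel
      _ ≤ ‖Φ t x - Φ t y‖ + ‖K • (x - y)‖ := norm_add_le _ _
      _ ≤ L * ‖x - y‖ + K * ‖x - y‖ := by
          gcongr
          · exact h.lipschitz t x hx y hy
          · rw [norm_smul, Real.norm_of_nonneg hK]
      _ = (L + K) * ‖x - y‖ := by ring
  aestronglyMeasurable w hw hwC :=
    (h.aestronglyMeasurable w hw hwC).add (hw.const_smul K).aestronglyMeasurable

/-- Solutions of a Carathéodory integral equation are unique. -/
theorem eqOn_of_integral_solution
    (h : CaratheodoryOn C L Φ) (h0 : (0 : E) ∈ C) {x₀ : E} {P Q : ℝ → E}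
    (hP : ContinuousOn P (Ici 0)) (hPC : ∀ t, 0 ≤ t → P t ∈ C)
    (hPeq : ∀ t, 0 ≤ t → P t = x₀ + ∫ s in (0 : ℝ)..t, Φ s (P s))
    (hQ : ContinuousOn Q (Ici 0)) (hQC : ∀ t, 0 ≤ t → Q t ∈ C)
    (hQeq : ∀ t, 0 ≤ t → Q t = x₀ + ∫ s in (0 : ℝ)..t, Φ s (Q s)) :
    EqOn Q P (Ici 0) := by
  have hext : ∀ R : ℝ → E, ContinuousOn R (Ici 0) → (∀ t, 0 ≤ t → R t ∈ C) →
      (∀ t, 0 ≤ t → R t = x₀ + ∫ s in (0 : ℝ)..t, Φ s (R s)) →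
      ∃ R' : ℝ → E, Continuous R' ∧ (∀ t, R' t ∈ C) ∧ (∀ t, 0 ≤ t → R' t = R t) ∧
        ∀ t, 0 ≤ t → R' t = x₀ + ∫ s in (0 : ℝ)..t, Φ s (R' s) := by
    intro R hR hRC hReq
    refine ⟨fun t => R (max t 0), hR.comp_continuous (by fun_prop) fun t => le_max_right t 0,
      fun t => hRC _ (le_max_right _ _), fun t ht => by simp [ht], fun t ht => ?_⟩
    simp only [max_eq_left ht]
    rw [hReq t ht]
    congr 1
    refine intervalIntegral.integral_congr fun s hs => ?_
    rw [uIcc_of_le ht] at hs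
    simp only [max_eq_left hs.1]
  obtain ⟨p, hpc, hpC, hpP, hp⟩ := hext P hP hPC hPeq
  obtain ⟨q, hqc, hqC, hqQ, hq⟩ := hext Q hQ hQC hQeq
  have hdc : Continuous fun s => ‖q s - p s‖ := (hqc.sub hpc).norm
  set H : ℝ → ℝ := fun t => ∫ s in (0 : ℝ)..t, ‖q s - p s‖ with hH
  have hHd : ∀ t, HasDerivAt H ‖q t - p t‖ t := fun t =>
    intervalIntegral.integral_hasDerivAt_right (hdc.intervalIntegrable _ _)
      (hdc.stronglyMeasurableAtFilter _ _) hdc.continuousAt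
  have hle : ∀ t, 0 ≤ t → ‖q t - p t‖ ≤ L * H t := by
    intro t ht
    rw [hq t ht, hp t ht, add_sub_add_left_eq_sub, ← intervalIntegral.integral_sub
      (h.intervalIntegrable h0 hqc hqC _ _) (h.intervalIntegrable h0 hpc hpC _ _),
      hH, ← intervalIntegral.integral_const_mul]
    exact intervalIntegral.norm_integral_le_of_norm_le ht
      (Filter.Eventually.of_forall fun s _ => h.lipschitz s _ (hqC s) _ (hpC s))
      ((continuous_const.mul hdc).intervalIntegrable _ _)
  have hH0 : ∀ t, 0 ≤ t → 0 ≤ H t := fun t ht =>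
    intervalIntegral.integral_nonneg ht fun s _ => norm_nonneg _
  intro t ht
  have ht : (0 : ℝ) ≤ t := ht
  have hzero : H t = 0 := by
    refine eq_zero_of_abs_deriv_le_mul_abs_self_of_eq_zero_right (K := L) (a := 0) (b := t)
      (f := H) (f' := fun t => ‖q t - p t‖)
      (fun s _ => (hHd s).continuousAt.continuousWithinAt) (fun s _ => (hHd s).hasDerivWithinAt)
      (by simp [hH]) (fun s hs => ?_) t ⟨ht, le_rfl⟩
    rw [norm_norm, Real.norm_of_nonneg (hH0 s hs.1)]
    exact hle s hs.1
  have := hle t ht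
  rw [hzero, mul_zero] at this
  rw [← hpP t ht, ← hqQ t ht]
  exact sub_eq_zero.1 (norm_le_zero_iff.1 this)

end CaratheodoryOn

variable [NormedSpace ℝ E]

/-- The cone of points at which all functionals of a family are nonnegative. -/
def nonnegCone {ι : Type*} (ℓ : ι → E →L[ℝ] ℝ) : Set E := {x | ∀ i, 0 ≤ ℓ i x}

theorem isClosed_nonnegCone {ι : Type*} (ℓ : ι → E →L[ℝ] ℝ) : IsClosed (nonnegCone ℓ) := by
  simp only [nonnegCone, ofPred_forall]
  exact isClosed_iInter fun i => isClosed_le continuous_const (ℓ i).continuous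

theorem zero_mem_nonnegCone {ι : Type*} (ℓ : ι → E →L[ℝ] ℝ) : (0 : E) ∈ nonnegCone ℓ :=
  fun i => by simp

theorem smul_mem_nonnegCone {ι : Type*} {ℓ : ι → E →L[ℝ] ℝ} {c : ℝ} (hc : 0 ≤ c) {x : E}
    (hx : x ∈ nonnegCone ℓ) : c • x ∈ nonnegCone ℓ := fun i => by
  simpa using mul_nonneg hc (hx i)

variable [CompleteSpace E]

theorem add_integral_mem_nonnegCone {ι : Type*} {ℓ : ι → E →L[ℝ] ℝ} {x₀ : E}
    (hx₀ : x₀ ∈ nonnegCone ℓ) {g : ℝ → E} {t : ℝ} (ht : 0 ≤ t)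
    (hg : IntervalIntegrable g volume 0 t) (hgC : ∀ s, g s ∈ nonnegCone ℓ) :
    x₀ + ∫ s in (0 : ℝ)..t, g s ∈ nonnegCone ℓ := fun i => by
  rw [map_add, ← ContinuousLinearMap.intervalIntegral_comp_comm _ hg]
  exact add_nonneg (hx₀ i) (intervalIntegral.integral_nonneg ht fun s _ => hgC s i)

theorem CaratheodoryOn.exists_integral_solution {ι : Type*} {ℓ : ι → E →L[ℝ] ℝ} {L : ℝ}
    {Φ : ℝ → E → E} (h : CaratheodoryOn (nonnegCone ℓ) L Φ) (hL : 0 ≤ L)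
    (hpos : ∀ t, ∀ x ∈ nonnegCone ℓ, Φ t x ∈ nonnegCone ℓ) {x₀ : E} (hx₀ : x₀ ∈ nonnegCone ℓ) :
    ∃ z : ℝ → E, Continuous z ∧ (∀ t, z t ∈ nonnegCone ℓ) ∧
      ∀ t, 0 ≤ t → z t = x₀ + ∫ s in (0 : ℝ)..t, Φ s (z s) := by
  set α : ℝ := 2 * L + 1 with hα
  have hα0 : 0 < α := by positivity
  have h0 := zero_mem_nonnegCone ℓ
  let S : Set (BoundedContinuousFunction ℝ E) := {w | ∀ t, w t ∈ nonnegCone ℓ}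
  have hS : IsClosed S := by
    simp only [S, ofPred_forall]
    exact isClosed_iInter fun t =>
      (isClosed_nonnegCone ℓ).preimage (by fun_prop)
  have hcont : ∀ w : S, Continuous fun s : ℝ => Real.exp (α * s) • w.1 s := fun w =>
    (by fun_prop : Continuous fun s : ℝ => Real.exp (α * s)).smul w.1.continuous
  have hmem : ∀ (w : S) (s : ℝ), Real.exp (α * s) • w.1 s ∈ nonnegCone ℓ := fun w s =>
    smul_mem_nonnegCone (Real.exp_pos _).le (w.2 s)
  have hint : ∀ (w : S) (a b : ℝ),
      IntervalIntegrable (fun s => Φ s (Real.exp (α * s) • w.1 s)) volume a b := fun w a b =>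
    h.intervalIntegrable h0 (hcont w) (hmem w) a b
  have hexp : ∀ t : ℝ, ∫ s in (0 : ℝ)..t, Real.exp (α * s) = (Real.exp (α * t) - 1) / α := by
    intro t
    rw [intervalIntegral.integral_comp_mul_left (fun s => Real.exp s) hα0.ne', integral_exp]
    simp only [mul_zero, Real.exp_zero, smul_eq_mul]
    ring
  have hbound : ∀ (F : ℝ → E) (c t : ℝ), 0 ≤ c → 0 ≤ t →
      (∀ s, ‖F s‖ ≤ L * (Real.exp (α * s) * c)) →
      ‖Real.exp (-(α * t)) • ∫ s in (0 : ℝ)..t, F s‖ ≤ 2⁻¹ * c := by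
    intro F c t hc ht hF
    have h1 : ‖∫ s in (0 : ℝ)..t, F s‖ ≤ ∫ s in (0 : ℝ)..t, L * (Real.exp (α * s) * c) :=
      intervalIntegral.norm_integral_le_of_norm_le ht
        (Filter.Eventually.of_forall fun s _ => hF s)
        ((by fun_prop : Continuous fun s : ℝ => L * (Real.exp (α * s) * c)).intervalIntegrable _ _)
    rw [intervalIntegral.integral_const_mul, intervalIntegral.integral_mul_const, hexp] at h1
    rw [norm_smul, Real.norm_of_nonneg (Real.exp_pos _).le]
    have h2 : L / α ≤ 2⁻¹ := by
      rw [div_le_iff₀ hα0]; linarith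
    calc Real.exp (-(α * t)) * ‖∫ s in (0 : ℝ)..t, F s‖
        ≤ Real.exp (-(α * t)) * (L * ((Real.exp (α * t) - 1) / α * c)) := by gcongr
      _ = (L / α) * c * (1 - Real.exp (-(α * t))) := by
          have : Real.exp (-(α * t)) * Real.exp (α * t) = 1 := by rw [← Real.exp_add]; simp
          linear_combination (L / α * c) * this
      _ ≤ (L / α) * c * 1 := by
          gcongr
          linarith [Real.exp_pos (-(α * t))]
      _ ≤ 2⁻¹ * c := by rw [mul_one]; gcongr
  have hT : ∀ w : S, ∃ v : S, ∀ t, v.1 t = Real.exp (-(α * max t 0)) •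
      (x₀ + ∫ s in (0 : ℝ)..max t 0, Φ s (Real.exp (α * s) • w.1 s)) := by
    intro w
    have hc : Continuous fun t : ℝ => Real.exp (-(α * max t 0)) •
        (x₀ + ∫ s in (0 : ℝ)..max t 0, Φ s (Real.exp (α * s) • w.1 s)) := by
      refine Continuous.smul (by fun_prop) (continuous_const.add ?_)
      exact (intervalIntegral.continuous_primitive (hint w) 0).comp
        (continuous_id.max continuous_const)
    refine ⟨⟨BoundedContinuousFunction.ofNormedAddCommGroup _ hc (‖x₀‖ + 2⁻¹ * ‖w.1‖) ?_, ?_⟩, ?_⟩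
    · intro t
      rw [smul_add]
      refine (norm_add_le _ _).trans (add_le_add ?_ (hbound _ _ _ (norm_nonneg _)
        (le_max_right _ _) ?_))
      · rw [norm_smul, Real.norm_of_nonneg (Real.exp_pos _).le]
        refine mul_le_of_le_one_left (norm_nonneg _) (Real.exp_le_one_iff.2 ?_)
        have := mul_nonneg hα0.le (le_max_right t 0)
        linarith
      · intro s
        refine (h.norm_le h0 s (hmem w s)).trans ?_
        rw [norm_smul, Real.norm_of_nonneg (Real.exp_pos _).le]
        gcongr
        exact w.1.norm_coe_le_norm s
    · intro t
      exact smul_mem_nonnegCone (Real.exp_pos _).le (add_integral_mem_nonnegCone hx₀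
        (le_max_right _ _) (hint w _ _) fun s => hpos s _ (hmem w s))
    · intro t; rfl
  choose T hT using hT
  have : CompleteSpace S := hS.completeSpace_coe
  have : Nonempty S := ⟨⟨0, fun t => by simpa using h0⟩⟩
  have hcontr : ContractingWith 2⁻¹ T := by
    refine ⟨by rw [← NNReal.coe_lt_coe]; norm_num, LipschitzWith.of_dist_le_mul fun w v => ?_⟩
    rw [Subtype.dist_eq, Subtype.dist_eq]
    refine (BoundedContinuousFunction.dist_le (by positivity)).2 fun t => ?_
    rw [dist_eq_norm, hT, hT, ← smul_sub, add_sub_add_left_eq_sub,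
      ← intervalIntegral.integral_sub (hint w _ _) (hint v _ _)]
    refine hbound _ _ _ dist_nonneg (le_max_right _ _) fun s => ?_
    refine (h.lipschitz s _ (hmem w s) _ (hmem v s)).trans ?_
    rw [← smul_sub, norm_smul, Real.norm_of_nonneg (Real.exp_pos _).le, ← dist_eq_norm]
    gcongr
    exact BoundedContinuousFunction.dist_coe_le_dist s
  have hfix : T (hcontr.fixedPoint T) = hcontr.fixedPoint T := hcontr.fixedPoint_isFixedPt
  set w := hcontr.fixedPoint T
  refine ⟨fun t => Real.exp (α * t) • w.1 t, hcont w, hmem w, fun t ht => ?_⟩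
  have h1 := hT w t
  rw [hfix, max_eq_left ht] at h1
  change Real.exp (α * t) • w.1 t = _
  rw [h1, smul_smul, ← Real.exp_add]
  simp

theorem exp_smul_eq_add_integral (K : ℝ) {g z : ℝ → E} {x₀ : E}
    (hg : ∀ t, IntervalIntegrable g volume 0 t) (hzc : Continuous z)
    (hz : ∀ t, 0 ≤ t → z t = x₀ + ∫ s in (0 : ℝ)..t, g s) {t : ℝ} (ht : 0 ≤ t) :
    Real.exp (-K * t) • z t =
      x₀ + ∫ s in (0 : ℝ)..t, Real.exp (-K * s) • (g s - K • z s) := by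
  have he : Continuous fun s : ℝ => Real.exp (-K * s) := by fun_prop
  have hgi : IntervalIntegrable (fun s => Real.exp (-K * s) • (g s - K • z s)) volume 0 t :=
    ((hg t).sub ((hzc.const_smul K).intervalIntegrable _ _)).continuousOn_smul he.continuousOn
  refine (SeparatingDual.eq_iff_forall_dual_eq (R := ℝ)).2 fun φ => ?_
  rw [map_add, ← ContinuousLinearMap.intervalIntegral_comp_comm _ hgi]
  have hφg : IntervalIntegrable (fun s => φ (g s)) volume 0 t :=
    ⟨φ.integrable_comp (hg t).1, φ.integrable_comp (hg t).2⟩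
  set Z : ℝ → ℝ := fun r => φ x₀ + ∫ s in (0 : ℝ)..r, φ (g s) with hZ
  have hzZ : ∀ r, 0 ≤ r → φ (z r) = Z r := fun r hr => by
    rw [hz r hr, map_add, ← ContinuousLinearMap.intervalIntegral_comp_comm _ (hg r)]
  have hacZ : AbsolutelyContinuousOnInterval Z 0 t :=
    AbsolutelyContinuousOnInterval.add
      (contDiff_const.contDiffOn.absolutelyContinuousOnInterval)
      (hφg.absolutelyContinuousOnInterval_intervalIntegral (by simp))
  have hace : AbsolutelyContinuousOnInterval (fun s : ℝ => Real.exp (-K * s)) 0 t :=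
    ContDiffOn.absolutelyContinuousOnInterval (by fun_prop)
  have key := AbsolutelyContinuousOnInterval.integral_mul_deriv_eq_deriv_mul hace hacZ
  have hd1 : ∀ s : ℝ, deriv (fun s : ℝ => Real.exp (-K * s)) s = -K * Real.exp (-K * s) := by
    intro s
    have : HasDerivAt (fun s : ℝ => Real.exp (-K * s)) (Real.exp (-K * s) * (-K * 1)) s :=
      ((hasDerivAt_id s).const_mul (-K)).exp
    rw [this.deriv]; ring
  have hd2 : ∫ s in (0 : ℝ)..t, Real.exp (-K * s) * deriv Z s =
      ∫ s in (0 : ℝ)..t, Real.exp (-K * s) * φ (g s) := by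
    refine intervalIntegral.integral_congr_ae ?_
    filter_upwards [hφg.ae_hasDerivAt_integral] with s hs hs'
    rw [((hs (uIoc_subset_uIcc hs') 0 (by simp)).const_add (φ x₀)).deriv]
  have hZ0 : Z 0 = φ x₀ := by simp [hZ]
  rw [hd2] at key
  simp only [hd1, hZ0] at key
  have hi1 : IntervalIntegrable (fun s => Real.exp (-K * s) * φ (g s)) volume 0 t :=
    hφg.continuousOn_mul he.continuousOn
  have hi2 : IntervalIntegrable (fun s => -K * Real.exp (-K * s) * Z s) volume 0 t :=
    ((continuous_const.mul he).continuousOn.mul hacZ.continuousOn).intervalIntegrable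
  have hfin : ∫ s in (0 : ℝ)..t, φ (Real.exp (-K * s) • (g s - K • z s)) =
      (∫ s in (0 : ℝ)..t, Real.exp (-K * s) * φ (g s)) +
        ∫ s in (0 : ℝ)..t, -K * Real.exp (-K * s) * Z s := by
    rw [← intervalIntegral.integral_add hi1 hi2]
    refine intervalIntegral.integral_congr fun s hs => ?_
    rw [uIcc_of_le ht] at hs
    simp only [map_smul, map_sub, smul_eq_mul, hzZ s hs.1]
    ring
  rw [hfin, key, map_smul, hzZ t ht]
  simp only [smul_eq_mul, mul_zero, Real.exp_zero]
  ring

/-- If `Φ + K` leaves the cone invariant, then the integral equation driven by `Φ` has a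
solution that stays in the cone. -/
theorem CaratheodoryOn.exists_nonneg_integral_solution {ι : Type*} {ℓ : ι → E →L[ℝ] ℝ} {L K : ℝ}
    {Φ : ℝ → E → E} (h : CaratheodoryOn (nonnegCone ℓ) L Φ) (hL : 0 ≤ L) (hK : 0 ≤ K)
    (hsmul : ∀ t, ∀ c : ℝ, 0 < c → ∀ x, Φ t (c • x) = c • Φ t x)
    (hpos : ∀ t, ∀ x ∈ nonnegCone ℓ, Φ t x + K • x ∈ nonnegCone ℓ) {x₀ : E}
    (hx₀ : x₀ ∈ nonnegCone ℓ) :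
    ∃ z : ℝ → E, Continuous z ∧ (∀ t, z t ∈ nonnegCone ℓ) ∧
      ∀ t, 0 ≤ t → z t = x₀ + ∫ s in (0 : ℝ)..t, Φ s (z s) := by
  have hΦ := h.add_smul_id hK
  obtain ⟨z, hzc, hzC, hz⟩ := hΦ.exists_integral_solution (by positivity) hpos hx₀
  refine ⟨fun t => Real.exp (-K * t) • z t,
    (by fun_prop : Continuous fun s : ℝ => Real.exp (-K * s)).smul hzc,
    fun t => smul_mem_nonnegCone (Real.exp_pos _).le (hzC t), fun t ht => ?_⟩
  have := exp_smul_eq_add_integral K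
    (fun t => hΦ.intervalIntegrable (zero_mem_nonnegCone ℓ) hzc hzC 0 t) hzc hz ht
  simpa only [add_sub_cancel_right, hsmul _ _ (Real.exp_pos _)] using this

end CaratheodoryODE

section RatioField

variable {E : Type*} [NormedAddCommGroup E] [NormedSpace ℝ E]

theorem div_le_inv_of_mul_le {a b c : ℝ} (hc : 0 < c) (ha : 0 ≤ a) (h : c * a ≤ b) :
    a / b ≤ c⁻¹ := by
  have hb : 0 ≤ b := (mul_nonneg hc.le ha).trans h
  refine div_le_of_le_mul₀ hb (inv_nonneg.2 hc.le) ?_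
  rw [inv_mul_eq_div, le_div_iff₀ hc]
  linarith

/-- A linear map rescaled by a ratio of two functionals is Lipschitz where the denominator
controls both the numerator and the linear map. -/
theorem norm_ratio_smul_sub_le (a b : E →L[ℝ] ℝ) (J : E →L[ℝ] E) {c D : ℝ} (hc : 0 < c)
    (hD : 0 ≤ D) {x y : E} (hax : 0 ≤ a x) (hbx : c * a x ≤ b x)
    (hay : 0 ≤ a y) (hby : c * a y ≤ b y) (hJy : ‖J y‖ ≤ D * b y) :
    ‖(a x / b x) • J x - (a y / b y) • J y‖ ≤
      (c⁻¹ * ‖J‖ + D * (c⁻¹ * ‖b‖ + ‖a‖)) * ‖x - y‖ := by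
  have hbx0 : 0 ≤ b x := (mul_nonneg hc.le hax).trans hbx
  have hby0 : 0 ≤ b y := (mul_nonneg hc.le hay).trans hby
  have hrx := div_le_inv_of_mul_le hc hax hbx
  have hrx0 : 0 ≤ a x / b x := div_nonneg hax hbx0
  have hA : |a x - a y| ≤ ‖a‖ * ‖x - y‖ := by
    rw [← map_sub, ← Real.norm_eq_abs]; exact a.le_opNorm _
  have hB : |b x - b y| ≤ ‖b‖ * ‖x - y‖ := by
    rw [← map_sub, ← Real.norm_eq_abs]; exact b.le_opNorm _
  have hsplit : (a x / b x) • J x - (a y / b y) • J y =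
      (a x / b x) • J (x - y) + (a x / b x - a y / b y) • J y := by
    rw [map_sub, smul_sub, sub_smul]; abel
  have h1 : ‖(a x / b x) • J (x - y)‖ ≤ c⁻¹ * (‖J‖ * ‖x - y‖) := by
    rw [norm_smul, Real.norm_of_nonneg hrx0]
    gcongr
    exact J.le_opNorm _
  have h2 : |a x / b x - a y / b y| * b y ≤ c⁻¹ * (‖b‖ * ‖x - y‖) + ‖a‖ * ‖x - y‖ := by
    rcases hby0.eq_or_lt with hby' | hby'
    · rw [← hby', mul_zero]; positivity
    have hay' : a y / b y * b y = a y := div_mul_cancel₀ _ hby'.ne'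
    rcases hbx0.eq_or_lt with hbx' | hbx'
    · have hax' : a x = 0 := by
        have : c * a x ≤ 0 := by rw [hbx']; exact hbx
        nlinarith
      rw [hax', zero_sub, abs_neg] at hA
      rw [hax', zero_div, zero_sub, abs_neg, abs_of_nonneg (div_nonneg hay hby0), hay']
      have : 0 ≤ c⁻¹ * (‖b‖ * ‖x - y‖) := by positivity
      linarith [le_abs_self (a y)]
    · have hax' : a x / b x * b x = a x := div_mul_cancel₀ _ hbx'.ne'
      calc |a x / b x - a y / b y| * b y = |(a x / b x - a y / b y) * b y| := by
            rw [abs_mul, abs_of_nonneg hby0]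
        _ = |-(a x / b x * (b x - b y)) + (a x - a y)| := by
            congr 1; linear_combination (-1) * hay' + hax'
        _ ≤ |-(a x / b x * (b x - b y))| + |a x - a y| := abs_add_le _ _
        _ ≤ c⁻¹ * (‖b‖ * ‖x - y‖) + ‖a‖ * ‖x - y‖ := by
            rw [abs_neg, abs_mul, abs_of_nonneg hrx0]
            gcongr
  rw [hsplit]
  refine (norm_add_le _ _).trans ?_
  have h3 : ‖(a x / b x - a y / b y) • J y‖ ≤
      D * (c⁻¹ * (‖b‖ * ‖x - y‖) + ‖a‖ * ‖x - y‖) := by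
    rw [norm_smul, Real.norm_eq_abs]
    calc |a x / b x - a y / b y| * ‖J y‖ ≤ |a x / b x - a y / b y| * (D * b y) := by gcongr
      _ = D * (|a x / b x - a y / b y| * b y) := by ring
      _ ≤ _ := by gcongr
  calc _ ≤ c⁻¹ * (‖J‖ * ‖x - y‖) + D * (c⁻¹ * (‖b‖ * ‖x - y‖) + ‖a‖ * ‖x - y‖) :=
        add_le_add h1 h3
    _ = _ := by ring

/-- The time-dependent vector field obtained from a linear field `A` and linear fields `J i`
weighted by intensities `lam t i` and by ratios of functionals. -/
noncomputable def ratioField {κ : Type*} [Fintype κ] (A : E →L[ℝ] E) (a b : κ → E →L[ℝ] ℝ)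
    (J : κ → E →L[ℝ] E) (lam : ℝ → κ → ℝ) (t : ℝ) (x : E) : E :=
  A x + ∑ i, lam t i • ((a i x / b i x) • J i x)

variable {κ : Type*} [Fintype κ] {A : E →L[ℝ] E} {a b : κ → E →L[ℝ] ℝ}
  {J : κ → E →L[ℝ] E} {lam : ℝ → κ → ℝ}

theorem ratioField_smul (t : ℝ) {c : ℝ} (hc : 0 < c) (x : E) :
    ratioField A a b J lam t (c • x) = c • ratioField A a b J lam t x := by
  simp only [ratioField, map_smul, smul_add, Finset.smul_sum, smul_eq_mul,
    mul_div_mul_left _ _ hc.ne']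
  congr 1
  refine Finset.sum_congr rfl fun i _ => ?_
  rw [smul_comm _ c, smul_comm _ c]

theorem caratheodoryOn_ratioField {C : Set E} {c D lamBar : ℝ} (hc : 0 < c) (hD : 0 ≤ D)
    (hlam : ∀ t i, 0 ≤ lam t i ∧ lam t i ≤ lamBar) (hmeas : ∀ i, Measurable fun t => lam t i)
    (ha : ∀ i, ∀ x ∈ C, 0 ≤ a i x) (hb : ∀ i, ∀ x ∈ C, c * a i x ≤ b i x)
    (hJ : ∀ i, ∀ x ∈ C, ‖J i x‖ ≤ D * b i x) :
    CaratheodoryOn C (‖A‖ + ∑ i, lamBar * (c⁻¹ * ‖J i‖ + D * (c⁻¹ * ‖b i‖ + ‖a i‖)))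
      (ratioField A a b J lam) where
  map_zero t := by simp [ratioField]
  lipschitz t x hx y hy := by
    have hsplit : ratioField A a b J lam t x - ratioField A a b J lam t y =
        A (x - y) + ∑ i, lam t i • ((a i x / b i x) • J i x - (a i y / b i y) • J i y) := by
      simp only [ratioField, map_sub, smul_sub, Finset.sum_sub_distrib]; abel
    rw [hsplit, add_mul, Finset.sum_mul]
    refine (norm_add_le _ _).trans (add_le_add (A.le_opNorm _) ?_)
    refine norm_sum_le_of_le _ fun i _ => ?_
    rw [norm_smul, Real.norm_of_nonneg (hlam t i).1, mul_assoc]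
    exact mul_le_mul (hlam t i).2 (norm_ratio_smul_sub_le (a i) (b i) (J i) hc hD (ha i x hx)
      (hb i x hx) (ha i y hy) (hb i y hy) (hJ i y hy)) (norm_nonneg _)
      ((hlam t i).1.trans (hlam t i).2)
  aestronglyMeasurable w hw hwC := by
    refine (A.continuous.comp hw).aestronglyMeasurable.add ?_
    refine Finset.aestronglyMeasurable_fun_sum _ fun i _ => ?_
    refine (hmeas i).aestronglyMeasurable.smul (Continuous.aestronglyMeasurable ?_)
    have hlip : LipschitzOnWith
        (c⁻¹ * ‖J i‖ + D * (c⁻¹ * ‖b i‖ + ‖a i‖)).toNNReal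
        (fun x => (a i x / b i x) • J i x) C :=
      LipschitzOnWith.of_dist_le_mul fun x hx y hy => by
        rw [Real.coe_toNNReal _ (by positivity), dist_eq_norm, dist_eq_norm]
        exact norm_ratio_smul_sub_le (a i) (b i) (J i) hc hD (ha i x hx)
          (hb i x hx) (ha i y hy) (hb i y hy) (hJ i y hy)
    exact hlip.continuousOn.comp_continuous hw hwC

end RatioField

section SummableSequences

variable {ι F : Type*} [NormedAddCommGroup F] [NormedSpace ℝ F]

theorem l1_summable_abs (x : lp (fun _ : ι => ℝ) 1) : Summable fun k => |x k| := by
  simpa using (lp.memℓp x).summable (by simp)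

theorem l1_norm_eq (x : lp (fun _ : ι => ℝ) 1) : ‖x‖ = ∑' k, |x k| := by
  simpa using lp.norm_eq_tsum_rpow (by simp) x

theorem memℓp_one_of_summable_abs {g : ι → ℝ} (hg : Summable fun k => |g k|) :
    Memℓp (E := fun _ : ι => ℝ) g 1 :=
  memℓp_gen (by simpa using hg)

theorem l1_summable_norm_smul {e : ι → F} {B : ℝ} (he : ∀ k, ‖e k‖ ≤ B)
    (x : lp (fun _ : ι => ℝ) 1) : Summable fun k => ‖x k • e k‖ := by
  refine Summable.of_nonneg_of_le (fun _ => norm_nonneg _) (fun k => ?_)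
    ((l1_summable_abs x).mul_right B)
  rw [norm_smul, Real.norm_eq_abs]
  exact mul_le_mul_of_nonneg_left (he k) (abs_nonneg _)

variable [CompleteSpace F]

/-- The continuous linear map on `ℓ¹` sending the `k`-th unit vector to `e k`. -/
noncomputable def l1Map (e : ι → F) (B : ℝ) (he : ∀ k, ‖e k‖ ≤ B) :
    lp (fun _ : ι => ℝ) 1 →L[ℝ] F :=
  LinearMap.mkContinuous
    { toFun := fun x => ∑' k, x k • e k
      map_add' := fun x y => by
        simp only [lp.coeFn_add, Pi.add_apply, add_smul]
        exact (l1_summable_norm_smul he x).of_norm.tsum_add (l1_summable_norm_smul he y).of_norm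
      map_smul' := fun c x => by
        simp only [lp.coeFn_smul, Pi.smul_apply, smul_assoc, RingHom.id_apply]
        exact (l1_summable_norm_smul he x).of_norm.tsum_const_smul c }
    B fun x => by
      change ‖∑' k, x k • e k‖ ≤ B * ‖x‖
      refine (norm_tsum_le_tsum_norm (l1_summable_norm_smul he x)).trans ?_
      rw [l1_norm_eq, ← tsum_mul_left]
      refine (l1_summable_norm_smul he x).tsum_le_tsum (fun k => ?_)
        ((l1_summable_abs x).mul_left B)
      rw [norm_smul, Real.norm_eq_abs, mul_comm]
      exact mul_le_mul_of_nonneg_right (he k) (abs_nonneg _)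

theorem l1Map_apply {e : ι → F} {B : ℝ} (he : ∀ k, ‖e k‖ ≤ B) (x : lp (fun _ : ι => ℝ) 1) :
    l1Map e B he x = ∑' k, x k • e k := rfl

theorem comp_l1Map_apply {G : Type*} [NormedAddCommGroup G] [NormedSpace ℝ G] (T : F →L[ℝ] G)
    {e : ι → F} {B : ℝ} (he : ∀ k, ‖e k‖ ≤ B) (x : lp (fun _ : ι => ℝ) 1) :
    T (l1Map e B he x) = ∑' k, x k • T (e k) := by
  rw [l1Map_apply, T.map_tsum (l1_summable_norm_smul he x).of_norm]
  simp only [map_smul]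

theorem l1Map_coord {ι' : Type*} {e : ι → lp (fun _ : ι' => ℝ) 1} {B : ℝ}
    (he : ∀ k, ‖e k‖ ≤ B) (x : lp (fun _ : ι => ℝ) 1) (q : ι') :
    l1Map e B he x q = ∑' k, x k * e k q :=
  comp_l1Map_apply (lp.evalCLM ℝ (fun _ : ι' => ℝ) 1 q) he x

/-- The functional summing all coordinates of an `ℓ¹` family. -/
noncomputable def l1Mass (ι : Type*) : lp (fun _ : ι => ℝ) 1 →L[ℝ] ℝ :=
  l1Map (fun _ => (1 : ℝ)) 1 fun _ => by simp

theorem l1Mass_apply (x : lp (fun _ : ι => ℝ) 1) : l1Mass ι x = ∑' k, x k := by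
  simp [l1Mass, l1Map_apply]

theorem l1Mass_single [DecidableEq ι] (k : ι) : l1Mass ι (lp.single 1 k (1 : ℝ)) = 1 := by
  rw [l1Mass_apply, tsum_eq_single k fun j hj => lp.single_apply_ne _ _ _ hj,
    lp.single_apply_self]

theorem l1_norm_eq_mass {x : lp (fun _ : ι => ℝ) 1} (hx : ∀ k, 0 ≤ x k) : ‖x‖ = l1Mass ι x := by
  rw [l1_norm_eq, l1Mass_apply]
  exact tsum_congr fun k => abs_of_nonneg (hx k)

variable {α β : Type*} [DecidableEq α]

theorem tsum_layer (i : α) (g : α × β → ℝ) :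
    ∑' p : α × β, (if p.1 = i then g p else 0) = ∑' l, g (i, l) := by
  rw [← (Prod.mk_right_injective i).tsum_eq]
  · simp
  · intro p hp
    have : p.1 = i := by
      by_contra h
      simp [h] at hp
    exact ⟨p.2, by rw [← this]⟩

theorem summable_layer (i : α) {g : β → ℝ} (hg : Summable g) :
    Summable fun p : α × β => if p.1 = i then g p.2 else 0 := by
  rw [← (Prod.mk_right_injective i).summable_iff]
  · simpa [Function.comp_def] using hg
  · intro p hp
    rw [if_neg]
    rintro rfl
    exact hp ⟨p.2, rfl⟩

/-- The `ℓ¹` family supported on the layer `i`, where it equals `g`. -/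
noncomputable def l1Layer (i : α) (g : β → ℝ) (hg : Summable g) :
    lp (fun _ : α × β => ℝ) 1 :=
  ⟨fun p => if p.1 = i then g p.2 else 0, memℓp_one_of_summable_abs (summable_layer i hg).abs⟩

theorem l1Layer_apply (i : α) {g : β → ℝ} (hg : Summable g) (p : α × β) :
    l1Layer i g hg p = if p.1 = i then g p.2 else 0 := rfl

theorem l1Layer_norm (i : α) {g : β → ℝ} (hg : Summable g) :
    ‖l1Layer i g hg‖ = ∑' l, |g l| := by
  rw [l1_norm_eq, ← tsum_layer i fun p => |g p.2|]
  refine tsum_congr fun p => ?_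
  rw [l1Layer_apply]
  split_ifs <;> simp

theorem l1Mass_l1Layer (i : α) {g : β → ℝ} (hg : Summable g) :
    l1Mass (α × β) (l1Layer i g hg) = ∑' l, g l := by
  rw [l1Mass_apply, ← tsum_layer i fun p => g p.2]
  rfl

end SummableSequences

section FokkerPlanck

variable {M : ℕ} {μ : Fin (M + 1) → ℕ → ℕ → ℝ} {f : ℕ → ℝ}

theorem intensity_tsum_abs (hμ_off : ∀ (i : Fin (M + 1)) (k j : ℕ), k ≠ j → 0 ≤ μ i k j)
    (hμ_diag : ∀ (i : Fin (M + 1)) (k : ℕ), μ i k k ≤ 0)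
    (hμ_row_summable : ∀ (i : Fin (M + 1)) (k : ℕ), Summable (μ i k))
    (hμ_row : ∀ (i : Fin (M + 1)) (k : ℕ), ∑' j : ℕ, μ i k j = 0) (i : Fin (M + 1)) (k : ℕ) :
    ∑' j, |μ i k j| = 2 * |μ i k k| := by
  have h : ∀ j, |μ i k j| = μ i k j + (if j = k then 2 * |μ i k k| else 0) := by
    intro j
    split_ifs with hj
    · subst hj; rw [abs_of_nonpos (hμ_diag i j)]; ring
    · rw [abs_of_nonneg (hμ_off i k j (Ne.symm hj)), add_zero]
  rw [tsum_congr h, (hμ_row_summable i k).tsum_add (hasSum_ite_eq k _).summable, hμ_row,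
    tsum_ite_eq, zero_add]

/-- The bounded operator on `ℓ¹` given by the intensity matrices acting on each layer. -/
noncomputable def generatorCLM (hsum : ∀ (i : Fin (M + 1)) (k : ℕ), Summable (μ i k)) (B : ℝ)
    (hB : ∀ i k, ∑' j, |μ i k j| ≤ B) : SLIl1 M →L[ℝ] SLIl1 M :=
  l1Map (fun p : Fin (M + 1) × ℕ => l1Layer p.1 (μ p.1 p.2) (hsum p.1 p.2)) B fun p => by
    rw [l1Layer_norm]; exact hB _ _

theorem generatorCLM_apply (hsum : ∀ (i : Fin (M + 1)) (k : ℕ), Summable (μ i k)) (B : ℝ)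
    (hB : ∀ i k, ∑' j, |μ i k j| ≤ B) (x : SLIl1 M) (q : Fin (M + 1) × ℕ) :
    generatorCLM hsum B hB x q = ∑' k, μ q.1 k q.2 * x (q.1, k) := by
  rw [generatorCLM, l1Map_coord, ← tsum_layer q.1 fun p => μ p.1 p.2 q.2 * x p]
  refine tsum_congr fun p => ?_
  rw [l1Layer_apply]
  by_cases h : p.1 = q.1
  · simp [h, mul_comm]
  · simp [h, Ne.symm h]

theorem l1Mass_generatorCLM (hsum : ∀ (i : Fin (M + 1)) (k : ℕ), Summable (μ i k)) (B : ℝ)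
    (hB : ∀ i k, ∑' j, |μ i k j| ≤ B) (hrow : ∀ i k, ∑' j, μ i k j = 0) (x : SLIl1 M) :
    l1Mass _ (generatorCLM hsum B hB x) = 0 := by
  rw [generatorCLM, comp_l1Map_apply]
  simp [l1Mass_l1Layer, hrow]

theorem neg_mul_le_generatorCLM (hsum : ∀ (i : Fin (M + 1)) (k : ℕ), Summable (μ i k)) {B K : ℝ}
    (hB : ∀ i k, ∑' j, |μ i k j| ≤ B) (hoff : ∀ i k j, k ≠ j → 0 ≤ μ i k j)
    (hK : ∀ i k, |μ i k k| ≤ K) {x : SLIl1 M} (hx : ∀ q, 0 ≤ x q) (q : Fin (M + 1) × ℕ) :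
    -K * x q ≤ generatorCLM hsum B hB x q := by
  have hs : Summable fun k => μ q.1 k q.2 * x (q.1, k) := by
    refine Summable.of_norm_bounded
      (((l1_summable_abs x).comp_injective (Prod.mk_right_injective q.1)).mul_left B) fun k => ?_
    rw [norm_mul, Real.norm_eq_abs, Real.norm_eq_abs]
    refine mul_le_mul_of_nonneg_right ?_ (abs_nonneg _)
    exact ((hsum q.1 k).abs.le_tsum q.2 fun _ _ => abs_nonneg _).trans (hB _ _)
  rw [generatorCLM_apply]
  refine le_trans ?_ (hs.le_tsum q.2 fun k hk => mul_nonneg (hoff _ _ _ hk) (hx _))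
  exact mul_le_mul_of_nonneg_right (neg_le_of_abs_le (hK _ _)) (hx q)

/-- The weighted mass `Σ_l g(l) x_l^i` of the layer `i`. -/
noncomputable def layerMass (M : ℕ) (g : ℕ → ℝ) (B : ℝ) (hg : ∀ j, |g j| ≤ B)
    (i : Fin (M + 1)) : SLIl1 M →L[ℝ] ℝ :=
  l1Map (fun p : Fin (M + 1) × ℕ => if p.1 = i then g p.2 else 0) B fun p => by
    split_ifs
    · exact hg _
    · simpa using (abs_nonneg _).trans (hg 0)

theorem layerMass_apply {g : ℕ → ℝ} {B : ℝ} (hg : ∀ j, |g j| ≤ B) (i : Fin (M + 1))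
    (x : SLIl1 M) : layerMass M g B hg i x = ∑' l, g l * x (i, l) := by
  rw [layerMass, l1Map_apply, ← tsum_layer i fun p => g p.2 * x p]
  refine tsum_congr fun p => ?_
  split_ifs <;> simp [mul_comm]

theorem layer_summable_mul {g : ℕ → ℝ} {B : ℝ} (hg : ∀ j, |g j| ≤ B) (i : Fin (M + 1))
    (x : SLIl1 M) : Summable fun l => g l * x (i, l) := by
  refine Summable.of_norm_bounded
    (((l1_summable_abs x).comp_injective (Prod.mk_right_injective i)).mul_left B) fun k => ?_
  rw [norm_mul, Real.norm_eq_abs, Real.norm_eq_abs]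
  exact mul_le_mul_of_nonneg_right (hg k) (abs_nonneg _)

/-- The operator moving mass from the layer `i` to the next one (cyclically) at rate `f`. -/
noncomputable def jumpCLM (M : ℕ) (f : ℕ → ℝ) (B : ℝ) (hf : ∀ j, |f j| ≤ B)
    (i : Fin (M + 1)) : SLIl1 M →L[ℝ] SLIl1 M :=
  l1Map (fun p : Fin (M + 1) × ℕ => (if p.1 = i then f p.2 else 0) •
    (lp.single 1 (i + 1, p.2) (1 : ℝ) - lp.single 1 (i, p.2) (1 : ℝ) : SLIl1 M)) (B * 2)
    fun p => by
      rw [norm_smul]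
      refine mul_le_mul ?_ ?_ (norm_nonneg _) ((abs_nonneg _).trans (hf 0))
      · split_ifs
        · exact hf _
        · simpa using (abs_nonneg _).trans (hf 0)
      · refine (norm_sub_le _ _).trans ?_
        rw [lp.norm_single (by simp), lp.norm_single (by simp)]
        norm_num

theorem jumpCLM_apply {B : ℝ} (hf : ∀ j, |f j| ≤ B) (i : Fin (M + 1)) (x : SLIl1 M)
    (q : Fin (M + 1) × ℕ) : jumpCLM M f B hf i x q =
      f q.2 * x (i, q.2) * ((if q.1 = i + 1 then 1 else 0) - (if q.1 = i then 1 else 0)) := by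
  rw [jumpCLM, l1Map_coord, tsum_eq_single (i, q.2)]
  · obtain ⟨q₁, q₂⟩ := q
    simp only [if_true, lp.coeFn_smul, lp.coeFn_sub, Pi.smul_apply, Pi.sub_apply, smul_eq_mul,
      lp.single_apply, Pi.single_apply, Prod.mk.injEq, and_true]
    ring
  · rintro ⟨k₁, k₂⟩ hk
    obtain ⟨q₁, q₂⟩ := q
    simp only [lp.coeFn_smul, lp.coeFn_sub, Pi.smul_apply, Pi.sub_apply, smul_eq_mul,
      lp.single_apply, Pi.single_apply, Prod.mk.injEq]
    by_cases h : k₁ = i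
    · have hne : ¬ q₂ = k₂ := fun h' => hk (by rw [h, h'])
      simp [hne]
    · simp [h]

theorem l1Mass_jumpCLM {B : ℝ} (hf : ∀ j, |f j| ≤ B) (i : Fin (M + 1)) (x : SLIl1 M) :
    l1Mass _ (jumpCLM M f B hf i x) = 0 := by
  rw [jumpCLM, comp_l1Map_apply]
  simp only [map_smul, map_sub, l1Mass_single, sub_self, smul_zero, tsum_zero]

theorem norm_jumpCLM_le {B : ℝ} (hf : ∀ j, |f j| ≤ B) (hf0 : ∀ j, 0 ≤ f j) (i : Fin (M + 1))
    {x : SLIl1 M} (hx : ∀ q, 0 ≤ x q) :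
    ‖jumpCLM M f B hf i x‖ ≤ 2 * layerMass M f B hf i x := by
  have hsum : Summable fun p : Fin (M + 1) × ℕ => x p * (if p.1 = i then f p.2 else 0) := by
    refine Summable.of_norm_bounded ((l1_summable_abs x).mul_right B) fun p => ?_
    rw [norm_mul]
    refine mul_le_mul_of_nonneg_left ?_ (norm_nonneg _)
    split_ifs
    · exact hf _
    · simpa using (abs_nonneg _).trans (hf 0)
  rw [jumpCLM, l1Map_apply, layerMass, l1Map_apply, ← tsum_mul_left]
  refine tsum_of_norm_bounded (hsum.mul_left 2).hasSum fun p => ?_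
  have hf' : 0 ≤ if p.1 = i then f p.2 else 0 := by
    split_ifs
    · exact hf0 _
    · exact le_rfl
  rw [norm_smul, norm_smul, Real.norm_of_nonneg (hx p), Real.norm_of_nonneg hf']
  have h2 : ‖(lp.single 1 (i + 1, p.2) (1 : ℝ) - lp.single 1 (i, p.2) (1 : ℝ) : SLIl1 M)‖ ≤ 2 := by
    refine (norm_sub_le _ _).trans ?_
    rw [lp.norm_single (by simp), lp.norm_single (by simp)]
    norm_num
  calc x p * ((if p.1 = i then f p.2 else 0) * _)
      ≤ x p * ((if p.1 = i then f p.2 else 0) * 2) := by gcongr; exact hx p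
    _ = 2 * (x p * (if p.1 = i then f p.2 else 0)) := by ring

theorem neg_mul_le_jumpCLM {B : ℝ} (hf : ∀ j, |f j| ≤ B) (hf0 : ∀ j, 0 ≤ f j) (i : Fin (M + 1))
    {x : SLIl1 M} (hx : ∀ q, 0 ≤ x q) (q : Fin (M + 1) × ℕ) :
    -B * x q ≤ jumpCLM M f B hf i x q := by
  have hB : 0 ≤ B := (abs_nonneg _).trans (hf 0)
  have hBx := mul_nonneg hB (hx q)
  have hfx := mul_nonneg (hf0 q.2) (hx (i, q.2))
  rw [jumpCLM_apply]
  by_cases h : q.1 = i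
  · have hq : x (i, q.2) = x q := by rw [← h]
    rw [hq] at hfx ⊢
    have : f q.2 * x q ≤ B * x q :=
      mul_le_mul_of_nonneg_right ((le_abs_self _).trans (hf _)) (hx q)
    rw [if_pos h]
    split_ifs <;> linarith
  · rw [if_neg h]
    split_ifs <;> linarith

variable {lam : ℝ → Fin (M + 1) → ℝ}

theorem ratioField_coord {ι κ : Type*} [Fintype κ]
    (A : lp (fun _ : ι => ℝ) 1 →L[ℝ] lp (fun _ : ι => ℝ) 1)
    (a b : κ → lp (fun _ : ι => ℝ) 1 →L[ℝ] ℝ)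
    (J : κ → lp (fun _ : ι => ℝ) 1 →L[ℝ] lp (fun _ : ι => ℝ) 1) (lam : ℝ → κ → ℝ) (t : ℝ)
    (x : lp (fun _ : ι => ℝ) 1) (q : ι) :
    ratioField A a b J lam t x q = A x q + ∑ i, lam t i * (a i x / b i x * J i x q) := by
  change lp.evalCLM ℝ (fun _ : ι => ℝ) 1 q (ratioField A a b J lam t x) = _
  simp only [ratioField, map_add, map_sum, map_smul, smul_eq_mul]
  rfl

/-- The drift of the Fokker–Planck equation as a vector field on `ℓ¹`. -/
theorem ratioField_eq_PsiFun (hsum : ∀ (i : Fin (M + 1)) (k : ℕ), Summable (μ i k)) {B Bf : ℝ}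
    (hB : ∀ i k, ∑' j, |μ i k j| ≤ B) (hf : ∀ j, |f j| ≤ Bf)
    (hlast : ∀ t, lam t (Fin.last M) = 0) (t : ℝ) (x : SLIl1 M) (q : Fin (M + 1) × ℕ) :
    ratioField (generatorCLM hsum B hB) (layerMass M (fun _ => 1) 1 (by simp))
      (layerMass M f Bf hf) (jumpCLM M f Bf hf) lam t x q =
      PsiFun M μ lam f t (fun r => x r) q := by
  have hin : (if 1 ≤ (q.1 : ℕ) then
        lam t (q.1 - 1) * f q.2 * x (q.1 - 1, q.2) *
          (∑' l : ℕ, x (q.1 - 1, l)) / (∑' l : ℕ, f l * x (q.1 - 1, l)) else 0) =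
      lam t (q.1 - 1) * f q.2 * x (q.1 - 1, q.2) *
          (∑' l : ℕ, x (q.1 - 1, l)) / (∑' l : ℕ, f l * x (q.1 - 1, l)) := by
    split_ifs with h
    · rfl
    · have h0 : q.1 = 0 := Fin.ext (by simpa using h)
      have h1 : q.1 - 1 = Fin.last M := by
        rw [h0, sub_eq_iff_eq_add, Fin.last_add_one]
      rw [h1, hlast]; simp
  have hout : (if (q.1 : ℕ) < M then
        lam t q.1 * f q.2 * x (q.1, q.2) *
          (∑' l : ℕ, x (q.1, l)) / (∑' l : ℕ, f l * x (q.1, l)) else 0) =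
      lam t q.1 * f q.2 * x (q.1, q.2) *
          (∑' l : ℕ, x (q.1, l)) / (∑' l : ℕ, f l * x (q.1, l)) := by
    split_ifs with h
    · rfl
    · have h1 : q.1 = Fin.last M := Fin.ext (by have := q.1.2; simp; omega)
      rw [h1, hlast]; simp
  have hnext : ∀ i : Fin (M + 1), (q.1 = i + 1) = (q.1 - 1 = i) := fun i => by
    rw [sub_eq_iff_eq_add]
  simp only [PsiFun]
  rw [hin, hout, ratioField_coord, generatorCLM_apply]
  simp only [layerMass_apply, jumpCLM_apply, one_mul, mul_sub, Finset.sum_sub_distrib, mul_ite,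
    mul_one, mul_zero, hnext, Finset.sum_ite_eq, Finset.mem_univ, if_true]
  ring

end FokkerPlanck

/-- There is a unique continuous `P : [0,∞) → E = ℓ¹(ℒ_M × ℕ)` which
satisfies simultaneously (i) `P(t) = P₀ + ∫₀ᵗ Ψ(s, P(s)) ds` (Bochner integral in `E`)
for all `t ≥ 0`, (ii) `P_j^i(t) ≥ 0` everywhere, (iii) `|P(t)| = 1` for all `t ≥ 0`:
the unique solution of the Fokker–Planck equation of the discrete SLI model. -/
theorem fokkerPlanck_wellposed (M : ℕ) (μ : Fin (M + 1) → ℕ → ℕ → ℝ)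
    (lam : ℝ → Fin (M + 1) → ℝ) (f : ℕ → ℝ) (fl fu lamBar : ℝ)
    -- bounds on `f`
    (hfl : 0 < fl) (hf : ∀ j : ℕ, fl ≤ f j ∧ f j ≤ fu)
    -- assumptions on the local intensity `λ`
    (hlamBar : 0 ≤ lamBar) (hlam : ∀ (t : ℝ) (i : Fin (M + 1)), 0 ≤ lam t i ∧ lam t i ≤ lamBar)
    (hlam_meas : ∀ i : Fin (M + 1), Measurable fun t => lam t i)
    (hlam_last : ∀ t : ℝ, lam t (Fin.last M) = 0)
    -- `μ^i` is an intensity matrix for every `i`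
    (hμ_off : ∀ (i : Fin (M + 1)) (k j : ℕ), k ≠ j → 0 ≤ μ i k j)
    (hμ_diag : ∀ (i : Fin (M + 1)) (k : ℕ), μ i k k ≤ 0)
    (hμ_row_summable : ∀ (i : Fin (M + 1)) (k : ℕ), Summable (μ i k))
    (hμ_row : ∀ (i : Fin (M + 1)) (k : ℕ), ∑' j : ℕ, μ i k j = 0)
    (hμ_bdd : ∀ i : Fin (M + 1), BddAbove (Set.range fun k : ℕ => |μ i k k|))
    -- initial condition
    (x₀ : Fin (M + 1)) (y₀ : ℕ) :
    ∃ P : ℝ → SLIl1 M, SolvesSLIFP M μ lam f x₀ y₀ P ∧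
      ∀ Q : ℝ → SLIl1 M, SolvesSLIFP M μ lam f x₀ y₀ Q → EqOn Q P (Ici 0) := by
  have hf0 : ∀ j, 0 ≤ f j := fun j => hfl.le.trans (hf j).1
  have hfabs : ∀ j, |f j| ≤ fu := fun j => by rw [abs_of_nonneg (hf0 j)]; exact (hf j).2
  have hfu : 0 ≤ fu := (hf0 0).trans (hf 0).2
  obtain ⟨K, hK⟩ : ∃ K, ∀ i k, |μ i k k| ≤ K := by
    choose c hc using hμ_bdd
    obtain ⟨K, hK⟩ := (Set.finite_range c).bddAbove
    exact ⟨K, fun i k => (hc i ⟨k, rfl⟩).trans (hK ⟨i, rfl⟩)⟩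
  have hK0 : 0 ≤ K := (abs_nonneg _).trans (hK 0 0)
  have hB : ∀ i k, ∑' j, |μ i k j| ≤ 2 * K := fun i k => by
    rw [intensity_tsum_abs hμ_off hμ_diag hμ_row_summable hμ_row]
    linarith [hK i k]
  have hone : ∀ _ : ℕ, |(1 : ℝ)| ≤ 1 := by simp
  set A : SLIl1 M →L[ℝ] SLIl1 M := generatorCLM hμ_row_summable (2 * K) hB
  set a : Fin (M + 1) → SLIl1 M →L[ℝ] ℝ := layerMass M (fun _ => 1) 1 hone
  set b : Fin (M + 1) → SLIl1 M →L[ℝ] ℝ := layerMass M f fu hfabs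
  set J : Fin (M + 1) → SLIl1 M →L[ℝ] SLIl1 M := jumpCLM M f fu hfabs
  have hΨ : ∀ t x q, ratioField A a b J lam t x q = PsiFun M μ lam f t (fun r => x r) q :=
    ratioField_eq_PsiFun hμ_row_summable hB hfabs hlam_last
  let ℓ : Fin (M + 1) × ℕ → SLIl1 M →L[ℝ] ℝ := fun q => lp.evalCLM ℝ (fun _ => ℝ) 1 q
  have ha : ∀ i, ∀ x ∈ nonnegCone ℓ, 0 ≤ a i x := fun i x hx => by
    rw [layerMass_apply]
    exact tsum_nonneg fun l => mul_nonneg zero_le_one (hx (i, l))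
  have hb : ∀ i, ∀ x ∈ nonnegCone ℓ, fl * a i x ≤ b i x := fun i x hx => by
    rw [layerMass_apply, layerMass_apply, ← tsum_mul_left]
    refine ((layer_summable_mul hone i x).mul_left fl).tsum_le_tsum (fun l => ?_)
      (layer_summable_mul hfabs i x)
    rw [one_mul]
    exact mul_le_mul_of_nonneg_right (hf l).1 (hx (i, l))
  have hC := caratheodoryOn_ratioField (A := A) (a := a) (b := b) (J := J) hfl zero_le_two hlam
    hlam_meas ha hb fun i x hx => norm_jumpCLM_le hfabs hf0 i hx
  have hpos : ∀ t, ∀ x ∈ nonnegCone ℓ, ratioField A a b J lam t x +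
      (K + ∑ _i : Fin (M + 1), lamBar * (fl⁻¹ * fu)) • x ∈ nonnegCone ℓ := fun t x hx q => by
    have hxq : 0 ≤ x q := hx q
    change 0 ≤ ratioField A a b J lam t x q + (K + ∑ _i : Fin (M + 1), lamBar * (fl⁻¹ * fu)) * x q
    have hA : -K * x q ≤ A x q := neg_mul_le_generatorCLM hμ_row_summable hB hμ_off hK hx q
    have hJ : ∑ _i : Fin (M + 1), -(lamBar * (fl⁻¹ * fu) * x q) ≤
        ∑ i, lam t i * (a i x / b i x * J i x q) := by
      refine Finset.sum_le_sum fun i _ => ?_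
      have hr0 : 0 ≤ a i x / b i x :=
        div_nonneg (ha i x hx) ((mul_nonneg hfl.le (ha i x hx)).trans (hb i x hx))
      have hr := div_le_inv_of_mul_le hfl (ha i x hx) (hb i x hx)
      calc -(lamBar * (fl⁻¹ * fu) * x q) = -(lamBar * (fl⁻¹ * (fu * x q))) := by ring
        _ ≤ -(lam t i * (a i x / b i x * (fu * x q))) := by
            gcongr
            exact (hlam t i).2
        _ = lam t i * (a i x / b i x * (-fu * x q)) := by ring
        _ ≤ lam t i * (a i x / b i x * J i x q) :=
            mul_le_mul_of_nonneg_left (mul_le_mul_of_nonneg_left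
              (neg_mul_le_jumpCLM hfabs hf0 i hx q) hr0) (hlam t i).1
    rw [Finset.sum_neg_distrib, ← Finset.sum_mul] at hJ
    rw [ratioField_coord]
    linarith
  have hx₀ : (lp.single 1 (x₀, y₀) (1 : ℝ) : SLIl1 M) ∈ nonnegCone ℓ := fun q => by
    change 0 ≤ (lp.single 1 (x₀, y₀) (1 : ℝ) : SLIl1 M) q
    rw [lp.single_apply]
    by_cases h : q = (x₀, y₀)
    · subst h; simp
    · simp [h]
  have hsmul : ∀ t, ∀ c : ℝ, 0 < c → ∀ x, ratioField A a b J lam t (c • x) =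
      c • ratioField A a b J lam t x := fun t c hc x => ratioField_smul t hc x
  have hL : 0 ≤ ‖A‖ +
      ∑ i, lamBar * (fl⁻¹ * ‖J i‖ + 2 * (fl⁻¹ * ‖b i‖ + ‖a i‖)) := by positivity
  have hK' : 0 ≤ K + ∑ _i : Fin (M + 1), lamBar * (fl⁻¹ * fu) := by positivity
  obtain ⟨P, hPc, hPC, hP⟩ := hC.exists_nonneg_integral_solution hL hK' hsmul hpos hx₀
  have hmass : ∀ t x, l1Mass _ (ratioField A a b J lam t x) = 0 := fun t x => by
    simp only [ratioField, map_add, map_sum, map_smul]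
    rw [l1Mass_generatorCLM hμ_row_summable _ hB hμ_row, zero_add]
    refine Finset.sum_eq_zero fun i _ => ?_
    rw [l1Mass_jumpCLM, smul_zero, smul_zero]
  refine ⟨P, ⟨hPc.continuousOn, ⟨fun s => ratioField A a b J lam s (P s),
    fun s _ q => hΨ s (P s) q, fun t ht => ?_⟩, fun t _ => hPC t, fun t ht => ?_⟩, ?_⟩
  · rw [← intervalIntegral.integral_of_le ht]
    exact hP t ht
  · rw [l1_norm_eq_mass (hPC t), hP t ht, map_add, l1Mass_single,
      ← ContinuousLinearMap.intervalIntegral_comp_comm _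
        (hC.intervalIntegrable (zero_mem_nonnegCone ℓ) hPc hPC 0 t)]
    simp [hmass]
  · rintro Q ⟨hQc, ⟨G, hG, hQ⟩, hQC, -⟩
    have hGeq : ∀ s, 0 ≤ s → G s = ratioField A a b J lam s (Q s) := fun s hs =>
      lp.ext (funext fun q => (hG s hs q).trans (hΨ s (Q s) q).symm)
    refine hC.eqOn_of_integral_solution (zero_mem_nonnegCone ℓ) hPc.continuousOn
      (fun t _ => hPC t) hP hQc hQC fun t ht => ?_
    rw [hQ t ht, intervalIntegral.integral_of_le ht]
    congr 1
    exact setIntegral_congr_fun measurableSet_Ioc fun s hs => hGeq s hs.1.le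
end

section
/- Let a, b : [0,∞) → ℝ be locally integrable functions with a(s) ≥ 0 for almost every s, and let p : [0,∞) → ℝ be continuous with p(0) ≥ 0 and such that p(t) = p(0) + ∫₀ᵗ ( a(s) − b(s) · max(p(s), 0) ) ds for all t ≥ 0. Then p(t) ≥ 0 for all t ≥ 0. -/
open MeasureTheory Set

/-- If `a, b : [0,∞) → ℝ` are locally integrable, `a(s) ≥ 0` for a.e.
`s ≥ 0`, and `p` is continuous with `p(0) ≥ 0` and
`p(t) = p(0) + ∫₀ᵗ (a(s) − b(s) max(p(s), 0)) ds` for all `t ≥ 0`, then `p(t) ≥ 0` for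
all `t ≥ 0`. -/
theorem nonneg_of_integral_eq (a b p : ℝ → ℝ)
    (ha_loc : LocallyIntegrableOn a (Ici 0))
    (hb_loc : LocallyIntegrableOn b (Ici 0))
    (ha_nonneg : ∀ᵐ s ∂(volume.restrict (Ici (0 : ℝ))), 0 ≤ a s)
    (hp_cont : Continuous p) (hp0 : 0 ≤ p 0)
    (hp : ∀ t : ℝ, 0 ≤ t →
      p t = p 0 + ∫ s in Ioc (0 : ℝ) t, (a s - b s * max (p s) 0)) :
    ∀ t : ℝ, 0 ≤ t → 0 ≤ p t := by
  intro t ht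
  by_contra! hneg
  -- The last time before `t` at which `p` is nonnegative.
  obtain ⟨u, ⟨⟨hu0, hut⟩, hpu⟩, hu⟩ :=
    (isCompact_Icc.inter_right (isClosed_le continuous_const hp_cont) :
      IsCompact (Icc 0 t ∩ {s | 0 ≤ p s})).exists_isGreatest ⟨0, ⟨le_rfl, ht⟩, hp0⟩
  have hlt (s : ℝ) (hs : s ∈ Ioc u t) : p s < 0 := by
    by_contra! h
    exact hs.1.not_ge (hu ⟨⟨hu0.trans hs.1.le, hs.2⟩, h⟩)
  have hint : IntegrableOn (fun s ↦ a s - b s * max (p s) 0) (Icc 0 t) :=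
    (ha_loc.integrableOn_compact_subset Icc_subset_Ici_self isCompact_Icc).sub
      ((hb_loc.integrableOn_compact_subset Icc_subset_Ici_self isCompact_Icc).mul_continuousOn
        (hp_cont.max continuous_const).continuousOn isCompact_Icc)
  have hsplit := setIntegral_union (Ioc_disjoint_Ioc_of_le le_rfl) measurableSet_Ioc
    (hint.mono_set ((Ioc_subset_Ioc_right hut).trans Ioc_subset_Icc_self))
    (hint.mono_set ((Ioc_subset_Ioc_left hu0).trans Ioc_subset_Icc_self))
  rw [Ioc_union_Ioc_eq_Ioc hu0 hut] at hsplit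
  have hnonneg : 0 ≤ ∫ s in Ioc u t, (a s - b s * max (p s) 0) := by
    refine setIntegral_nonneg_of_ae_restrict ?_
    filter_upwards [ae_restrict_of_ae_restrict_of_subset
      (fun s hs ↦ hu0.trans hs.1.le : Ioc u t ⊆ Ici 0) ha_nonneg,
      ae_restrict_mem measurableSet_Ioc] with s has hs
    simpa [max_eq_right (hlt s hs).le] using has
  have hpu' : 0 ≤ p u := hpu
  linarith [hp t ht, hp u hu0]
end
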